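/- Let d ≥ 3, k ≥ 1, and let T ⊂ ℝ^d be a clean lattice d-simplex whose interior contains exactly k lattice points and whose volume is Vol(T) = (dk + 1)/d!. Then T is unimodularly equivalent to T_{a_1,…,a_d}, where a_i = dk for 1 ≤ i ≤ d−1 and a_d = dk + 1. -/

import Mathlib

open MeasureTheory Set
open scoped ENNReal

noncomputable section

/-- A point of `ℝ^d` is a lattice point if all its coordinates are integers. -/
def IsLatticePt (d : ℕ) (x : Fin d → ℝ) : Prop := ∀ i, ∃ z : ℤ, x i = (z : ℝ)

/-- A lattice `d`-simplex: the convex hull of `d+1` affinely independent points of `ℤ^d`. -/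
def IsLatticeSimplex (d : ℕ) (T : Set (Fin d → ℝ)) : Prop :=
  ∃ v : Fin (d + 1) → Fin d → ℤ,
    AffineIndependent ℝ (fun i => fun j => ((v i j : ℤ) : ℝ)) ∧
    T = convexHull ℝ (Set.range (fun i => fun j => ((v i j : ℤ) : ℝ)))

/-- A lattice `d`-polytope: convex hull of a finite set of lattice points affinely
spanning `ℝ^d`. -/
def IsLatticePolytope (d : ℕ) (P : Set (Fin d → ℝ)) : Prop :=
  ∃ F : Finset (Fin d → ℤ),
    affineSpan ℝ ((fun v : Fin d → ℤ => fun j : Fin d => (v j : ℝ)) '' ↑F) = ⊤ ∧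
    P = convexHull ℝ ((fun v : Fin d → ℤ => fun j : Fin d => (v j : ℝ)) '' ↑F)

/-- Clean: the only lattice points on the boundary are the vertices (extreme points). -/
def IsClean (d : ℕ) (P : Set (Fin d → ℝ)) : Prop :=
  frontier P ∩ {x | IsLatticePt d x} = Set.extremePoints ℝ P

/-- Unimodular equivalence of subsets of `ℝ^d`. -/
def UnimodEquiv (d : ℕ) (P Q : Set (Fin d → ℝ)) : Prop :=
  ∃ (M : Matrix (Fin d) (Fin d) ℤ) (u : Fin d → ℤ),
    (M.det = 1 ∨ M.det = -1) ∧
    (fun x => (M.map (fun z : ℤ => (z : ℝ))).mulVec x + (fun i => (u i : ℝ))) '' P = Q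

/-- `S_d(k) = conv(e_1, …, e_d, -k(e_1 + ⋯ + e_d))`. -/
def Sdk (d k : ℕ) : Set (Fin d → ℝ) :=
  convexHull ℝ
    ((Set.range fun i : Fin d => (Pi.single i 1 : Fin d → ℝ)) ∪ {fun _ => -(k : ℝ)})

/-- `T_{a_1,…,a_d}`: vertex set `{0, e_1, …, e_{d-1}, (a_1,…,a_d)}`. -/
def Ta (d : ℕ) (a : Fin d → ℤ) : Set (Fin d → ℝ) :=
  convexHull ℝ
    ({(0 : Fin d → ℝ)} ∪
      {x | ∃ i : Fin d, i.val < d - 1 ∧ x = (Pi.single i 1 : Fin d → ℝ)} ∪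
      {fun i => (a i : ℝ)})

open scoped Pointwise in
theorem scherk {G : Type*} [AddCommGroup G] [DecidableEq G] (n : ℕ) :
    ∀ (A B : Finset G), B.card = n → (0:G) ∈ A → (0:G) ∈ B →
    (∀ a ∈ A, ∀ b ∈ B, a + b = 0 → b = 0) → A.card + B.card ≤ (A + B).card + 1 := by
  induction n using Nat.strong_induction_on with
  | _ n ih =>
  intro A B hB hA0 hB0 huniq
  by_cases hb : ∃ b ∈ B, b ≠ 0
  · obtain ⟨b, hbB, hb0⟩ := hb
    have hex : ∃ a ∈ A, ∃ b' ∈ B, a + b' ∉ A := by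
      by_contra! hcon
      have hmul : ∀ m : ℕ, m • b ∈ A := by
        intro m
        induction m with
        | zero => simpa using hA0
        | succ m ihm => rw [succ_nsmul]; exact hcon _ ihm _ hbB
      have hfin : ¬ Function.Injective (fun m : ℕ => m • b) := by
        intro hinj
        exact (Set.infinite_of_injective_forall_mem hinj (s := (A : Set G)) hmul) A.finite_toSet
      simp only [Function.Injective, not_forall] at hfin
      obtain ⟨m1, m2, h12, hne⟩ := hfin
      have key : ∃ m : ℕ, (m + 1) • b = 0 := by
        rcases lt_or_gt_of_ne hne with h | h
        · refine ⟨m2 - m1 - 1, ?_⟩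
          have : m2 = m1 + (m2 - m1 - 1 + 1) := by omega
          rw [this, add_nsmul] at h12
          simpa using h12.symm
        · refine ⟨m1 - m2 - 1, ?_⟩
          have : m1 = m2 + (m1 - m2 - 1 + 1) := by omega
          rw [this, add_nsmul] at h12
          simpa using h12
      obtain ⟨m, hm⟩ := key
      rw [succ_nsmul] at hm
      exact hb0 (huniq _ (hmul m) _ hbB hm)
    obtain ⟨a, haA, b', hb'B, hab'⟩ := hex
    set C : Finset G := B.image (fun x => a + x) with hC
    set A' := A ∪ C with hA'
    set B' := B.filter (fun x => a + x ∈ A) with hB'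
    have hlt : B'.card < B.card := by
      apply Finset.card_lt_card
      rw [Finset.ssubset_iff_of_subset (Finset.filter_subset _ _)]
      exact ⟨b', hb'B, by simp [hB', hab']⟩
    have hcard : A'.card + B'.card = A.card + B.card := by
      have h1 : A'.card + (A ∩ C).card = A.card + C.card := Finset.card_union_add_card_inter A C
      have h2 : C.card = B.card := Finset.card_image_of_injective _ (add_right_injective a)
      have h3 : (A ∩ C).card = B'.card := by
        rw [← Finset.card_image_of_injective B' (add_right_injective a)]
        congr 1
        ext x
        simp only [hC, hB', Finset.mem_inter, Finset.mem_image, Finset.mem_filter]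
        constructor
        · rintro ⟨hx, y, hy, rfl⟩; exact ⟨y, ⟨hy, hx⟩, rfl⟩
        · rintro ⟨y, ⟨hy, hx⟩, rfl⟩; exact ⟨hx, y, hy, rfl⟩
      omega
    have hsub : A' + B' ⊆ A + B := by
      intro x hx
      rw [Finset.mem_add] at hx
      obtain ⟨y, hy, z, hz, rfl⟩ := hx
      simp only [hB', Finset.mem_filter] at hz
      simp only [hA', hC, Finset.mem_union, Finset.mem_image] at hy
      rcases hy with hy | ⟨y', hy', rfl⟩
      · exact Finset.add_mem_add hy hz.1
      · rw [show a + y' + z = (a + z) + y' by abel]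
        exact Finset.add_mem_add hz.2 hy'
    have := ih B'.card (by omega) A' B' rfl (by simp [hA', hA0]) (by simp [hB', hB0, haA]) (by
      intro y hy z hz hyz
      simp only [hB', Finset.mem_filter] at hz
      simp only [hA', hC, Finset.mem_union, Finset.mem_image] at hy
      rcases hy with hy | ⟨y', hy', rfl⟩
      · exact huniq y hy z hz.1 hyz
      · have h0 : (a + z) + y' = 0 := by rw [← hyz]; abel
        have hy0 := huniq _ hz.2 _ hy' h0
        subst hy0
        rw [add_zero] at hyz
        exact huniq a haA z hz.1 hyz)
    have := Finset.card_le_card hsub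
    omega
  · push Not at hb
    have : B = {0} := by
      ext x; simp only [Finset.mem_singleton]; exact ⟨hb x, fun h => h ▸ hB0⟩
    subst this
    simp

open scoped Pointwise in
/-- AP lemma -/
theorem ap_lemma (S : Finset ℕ) (h0 : 0 ∈ S) (h2 : 2 ≤ S.card)
    (hs : (S + S).card ≤ 2 * S.card - 1) :
    ∃ q, 0 < q ∧ S = (Finset.range S.card).image (fun j => j * q) := by
  classical
  have hne : S.Nonempty := ⟨0, h0⟩
  obtain ⟨m, hmS, hmax⟩ : ∃ m ∈ S, ∀ a ∈ S, a ≤ m := ⟨S.max' hne, S.max'_mem hne, fun a ha => S.le_max' a ha⟩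
  have hne' : (S.erase 0).Nonempty := by
    rw [← Finset.card_pos, Finset.card_erase_of_mem h0]; omega
  obtain ⟨q, hqS, hq0, hqmin⟩ : ∃ q ∈ S, q ≠ 0 ∧ ∀ a ∈ S, a ≠ 0 → q ≤ a := by
    refine ⟨(S.erase 0).min' hne', ?_, ?_, ?_⟩
    · exact Finset.mem_of_mem_erase (Finset.min'_mem _ hne')
    · exact Finset.ne_of_mem_erase (Finset.min'_mem _ hne')
    · intro a ha ha0
      exact Finset.min'_le _ _ (Finset.mem_erase.2 ⟨ha0, ha⟩)
  -- S ∪ (S + m) = S + S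
  set U : Finset ℕ := S ∪ S.image (fun x => x + m) with hU
  have hUsub : U ⊆ S + S := by
    intro x hx
    rw [hU, Finset.mem_union, Finset.mem_image] at hx
    rcases hx with hx | ⟨y, hy, rfl⟩
    · simpa using Finset.add_mem_add hx h0
    · exact Finset.add_mem_add hy hmS
  have hUcard : U.card + 1 = 2 * S.card := by
    have h1 : U.card + (S ∩ S.image (fun x => x + m)).card = S.card + (S.image (fun x => x + m)).card :=
      Finset.card_union_add_card_inter _ _
    have h3 : (S.image (fun x => x + m)).card = S.card := Finset.card_image_of_injective _ (add_left_injective m)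
    have h4 : S ∩ S.image (fun x => x + m) = {m} := by
      ext x
      simp only [Finset.mem_inter, Finset.mem_image, Finset.mem_singleton]
      constructor
      · rintro ⟨hx, y, hy, rfl⟩
        have := hmax _ hx
        omega
      · rintro rfl; exact ⟨hmS, 0, h0, by simp⟩
    rw [h4, h3, Finset.card_singleton] at h1
    omega
  have hUeq : U = S + S := Finset.eq_of_subset_of_card_le hUsub (by omega)
  have step : ∀ a ∈ S, a < m → a + q ∈ S := by
    intro a ha ham
    have : a + q ∈ U := by rw [hUeq]; exact Finset.add_mem_add ha hqS
    rw [hU, Finset.mem_union, Finset.mem_image] at this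
    rcases this with h | ⟨y, hy, hyq⟩
    · exact h
    · by_cases hy0 : y = 0
      · subst hy0; have : a + q = m := by omega
        rw [this]; exact hmS
      · have := hqmin y hy hy0; omega
  have hle : ∀ n : ℕ, ∀ a ∈ S, m - a = n → ∃ t, a + t * q = m := by
    intro n
    induction n using Nat.strong_induction_on with
    | _ n ih =>
    intro a ha hn
    by_cases ham : a < m
    · have h1 := step a ha ham
      have h2 := hmax _ h1
      obtain ⟨t, ht⟩ := ih (m - (a + q)) (by omega) (a+q) h1 rfl
      exact ⟨t + 1, by rw [← ht]; ring⟩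
    · exact ⟨0, by have := hmax a ha; omega⟩
  obtain ⟨t0, ht0⟩ := hle _ 0 h0 rfl
  have hall : ∀ j ≤ t0, j * q ∈ S := by
    intro j
    induction j with
    | zero => intro _; simpa using h0
    | succ j ihj =>
      intro hj
      rw [Nat.succ_mul]
      refine step _ (ihj (by omega)) ?_
      rw [← ht0, zero_add]
      exact Nat.mul_lt_mul_of_pos_right (by omega) (by omega)
  have hSeq : S = (Finset.range (t0 + 1)).image (fun j => j * q) := by
    ext x
    simp only [Finset.mem_image, Finset.mem_range]
    constructor
    · intro hx
      obtain ⟨t, ht⟩ := hle _ x hx rfl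
      have htt : t ≤ t0 := by
        by_contra hlt
        push Not at hlt
        have : t0 * q < t * q := Nat.mul_lt_mul_of_pos_right hlt (by omega)
        omega
      refine ⟨t0 - t, by omega, ?_⟩
      rw [Nat.sub_mul]; omega
    · rintro ⟨j, hj, rfl⟩; exact hall j (by omega)
  have hc : S.card = t0 + 1 := by
    rw [hSeq, Finset.card_image_of_injective, Finset.card_range]
    intro x y hxy
    exact Nat.eq_of_mul_eq_mul_right (by omega) hxy
  exact ⟨q, by omega, by rw [hc]; exact hSeq⟩

def cnt (Q : Finset ℕ) (a b : ℕ) : ℕ := (Q.filter (fun x => a ≤ x ∧ x < b)).card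

theorem cnt_add (Q : Finset ℕ) {a b c : ℕ} (h1 : a ≤ b) (h2 : b ≤ c) :
    cnt Q a b + cnt Q b c = cnt Q a c := by
  unfold cnt
  rw [← Finset.card_union_of_disjoint]
  · congr 1
    ext x
    simp only [Finset.mem_union, Finset.mem_filter]
    constructor
    · rintro (⟨h, h'⟩ | ⟨h, h'⟩)
      · exact ⟨h, by omega⟩
      · exact ⟨h, by omega⟩
    · rintro ⟨h, h'⟩
      by_cases hx : x < b
      · left; exact ⟨h, by omega⟩
      · right; exact ⟨h, by omega⟩
  · rw [Finset.disjoint_left]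
    intro x hx hx'
    simp only [Finset.mem_filter] at hx hx'
    omega

theorem cnt_all (Q : Finset ℕ) {b : ℕ} (h : ∀ x ∈ Q, x < b) : cnt Q 0 b = Q.card := by
  unfold cnt
  congr 1
  rw [Finset.filter_eq_self]
  intro x hx
  exact ⟨Nat.zero_le _, h x hx⟩

theorem cnt_eq_zero (Q : Finset ℕ) {a b : ℕ} (h : cnt Q a b = 0) : ∀ x ∈ Q, a ≤ x → b ≤ x := by
  intro x hx ha
  by_contra hb
  unfold cnt at h
  rw [Finset.card_eq_zero] at h
  have : x ∈ Q.filter (fun x => a ≤ x ∧ x < b) := by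
    rw [Finset.mem_filter]; exact ⟨hx, ha, by omega⟩
  rw [h] at this
  simp at this

theorem cnt_sum (Q : Finset ℕ) (e M : ℕ) :
    ∑ t ∈ Finset.range M, cnt Q (t * e) ((t + 1) * e) = cnt Q 0 (M * e) := by
  induction M with
  | zero =>
    simp only [Finset.range_zero, Finset.sum_empty, zero_mul]
    unfold cnt; symm; rw [Finset.card_eq_zero, Finset.filter_eq_empty_iff]
    intro x _ h; omega
  | succ n ih =>
    rw [Finset.sum_range_succ, ih]
    exact cnt_add Q (Nat.zero_le _) (Nat.mul_le_mul_right _ (by omega))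

/-- Descend into a window. -/
theorem descend (Q : Finset ℕ) (e : ℕ) (he : 0 < e) (hQ : ∀ a ∈ Q, e < a → a - e ∈ Q) (θ : ℕ) (hθ : 1 ≤ θ) :
    ∀ n, ∀ y ∈ Q, y = n → θ ≤ y → ∃ y' ∈ Q, θ ≤ y' ∧ y' < θ + e ∧ ∃ c, y = y' + c * e := by
  intro n
  induction n using Nat.strong_induction_on with
  | _ n ih =>
  intro y hy hyn hθy
  by_cases h : y < θ + e
  · exact ⟨y, hy, hθy, h, 0, by simp⟩
  · obtain ⟨y', h1, h2, h3, c, hc⟩ := ih (y - e) (by omega) (y - e) (hQ y hy (by omega)) rfl (by omega)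
    refine ⟨y', h1, h2, h3, c + 1, ?_⟩
    rw [add_mul]; omega

theorem not_mult (Q : Finset ℕ) (e : ℕ) (hQ : ∀ a ∈ Q, e < a → a - e ∈ Q)
    (he : 0 < e) (heQ : e ∉ Q) (h0 : 0 ∉ Q) : ∀ c, c * e ∉ Q := by
  intro c
  induction c with
  | zero => simpa using h0
  | succ c ih =>
    intro hc
    by_cases hc0 : c = 0
    · subst hc0; simp at hc; exact heQ hc
    · have : e < (c+1) * e := by nlinarith [Nat.pos_of_ne_zero hc0]
      have := hQ _ hc this
      rw [add_mul] at this
      simp at this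
      exact ih this

theorem cast_inj_window (e θ a b : ℕ) (ha : θ ≤ a ∧ a < θ + e) (hb : θ ≤ b ∧ b < θ + e)
    (h : (a : ZMod e) = b) : a = b := by
  rw [ZMod.natCast_eq_natCast_iff] at h
  rcases le_total a b with hab | hab
  · have := (Nat.modEq_iff_dvd' hab).1 h
    have := Nat.eq_zero_of_dvd_of_lt this (by omega)
    omega
  · have := (Nat.modEq_iff_dvd' hab).1 h.symm
    have := Nat.eq_zero_of_dvd_of_lt this (by omega)
    omega

theorem card_window (Q : Finset ℕ) (e θ : ℕ) :
    ((Q.filter (fun x => θ ≤ x ∧ x < θ + e)).image (fun x : ℕ => (x : ZMod e))).card = cnt Q θ (θ + e) := by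
  unfold cnt
  apply Finset.card_image_of_injOn
  intro a ha b hb hab
  simp only [Finset.coe_filter, Set.mem_ofPred_eq] at ha hb
  exact cast_inj_window e θ a b ha.2 hb.2 hab

structure CombHyp (N e : ℕ) (S P : Finset ℕ) : Prop where
  he : 0 < e
  heN : 2 * e < N
  hxS : N - e ∈ S
  hmax : ∀ a ∈ S, a ≤ N - e
  S1 : ∀ a ∈ S, 1 ≤ a ∧ a < N
  P1 : ∀ a ∈ P, 1 ≤ a ∧ a < N
  SP : S ⊆ P
  SSN : ∀ a ∈ S, ∀ b ∈ S, a + b ≠ N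
  SSP : ∀ a ∈ S, ∀ b ∈ S, a + b < N → a + b ∈ P
  SSS : ∀ a ∈ S, ∀ b ∈ S, N < a + b → a + b - N ∈ S
  PSN : ∀ a ∈ P, ∀ b ∈ S, a + b ≠ N
  PSP : ∀ a ∈ P, ∀ b ∈ S, N < a + b → a + b - N ∈ P

namespace CombHyp
variable {N e : ℕ} {S P : Finset ℕ}

theorem Sdown (h : CombHyp N e S P) : ∀ a ∈ S, e < a → a - e ∈ S := by
  intro a ha hea
  have := h.SSS a ha _ h.hxS (by have := h.heN; omega)
  have h2 := h.heN
  convert this using 1; omega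

theorem Pdown (h : CombHyp N e S P) : ∀ a ∈ P, e < a → a - e ∈ P := by
  intro a ha hea
  have := h.PSP a ha _ h.hxS (by have := h.heN; omega)
  have h2 := h.heN
  convert this using 1; omega

theorem eP (h : CombHyp N e S P) : e ∉ P := by
  intro he
  have := h.PSN e he _ h.hxS
  have h2 := h.heN
  omega

theorem Pmult (h : CombHyp N e S P) (c : ℕ) : c * e ∉ P :=
  not_mult P e h.Pdown h.he h.eP (fun h0 => by have := h.P1 0 h0; omega) c

theorem Smult (h : CombHyp N e S P) (c : ℕ) : c * e ∉ S := fun hc => h.Pmult c (h.SP hc)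

theorem Pndvd (h : CombHyp N e S P) {a : ℕ} (ha : a ∈ P) : ¬ e ∣ a := by
  rintro ⟨c, rfl⟩
  rw [mul_comm] at ha
  exact h.Pmult c ha

theorem I1 (h : CombHyp N e S P) : 2 * cnt S 0 e ≤ cnt P 0 e := by
  classical
  set R := S.filter (fun x => 0 ≤ x ∧ x < e) with hR
  set R' := insert 0 R with hR'
  have h0R : 0 ∉ R := by
    intro h0
    have := h.S1 0 (Finset.mem_filter.1 h0).1
    omega
  set A : Finset (ZMod e) := R'.image (fun x : ℕ => (x : ZMod e)) with hA
  have hR'lt : ∀ a ∈ R', a < e := by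
    intro a ha
    rw [hR', Finset.mem_insert] at ha
    rcases ha with rfl | ha
    · exact h.he
    · exact (Finset.mem_filter.1 ha).2.2
  have hcA : A.card = cnt S 0 e + 1 := by
    rw [hA, Finset.card_image_of_injOn, hR', Finset.card_insert_of_notMem h0R]
    · rfl
    · intro a ha b hb hab
      exact cast_inj_window e 0 a b ⟨Nat.zero_le _, by simpa using hR'lt a ha⟩ ⟨Nat.zero_le _, by simpa using hR'lt b hb⟩ hab
  have h0A : (0 : ZMod e) ∈ A := by
    rw [hA, Finset.mem_image]; exact ⟨0, by simp [hR'], by simp⟩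
  have hsum : ∀ a ∈ R', ∀ b ∈ R', a + b = 0 ∨ a + b ∈ P := by
    intro a ha b hb
    have h1 := hR'lt a ha
    have h2 := hR'lt b hb
    have h3 := h.heN
    rw [hR', Finset.mem_insert] at ha hb
    rcases ha with rfl | ha
    · rcases hb with rfl | hb
      · left; rfl
      · right; rw [zero_add]; exact h.SP (Finset.mem_filter.1 hb).1
    · rcases hb with rfl | hb
      · right; rw [add_zero]; exact h.SP (Finset.mem_filter.1 ha).1
      · right
        exact h.SSP _ (Finset.mem_filter.1 ha).1 _ (Finset.mem_filter.1 hb).1 (by omega)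
  have key := scherk A.card A A rfl h0A h0A (by
    intro a ha b hb hab
    rw [hA, Finset.mem_image] at ha hb
    obtain ⟨a, ha, rfl⟩ := ha
    obtain ⟨b, hb, rfl⟩ := hb
    rcases hsum a ha b hb with h0 | h0
    · have : b = 0 := by omega
      simp [this]
    · exfalso
      apply h.Pndvd h0
      rw [← Nat.cast_add, ZMod.natCast_eq_zero_iff] at hab
      exact hab)
  open Pointwise in
  have hsub : A + A ⊆ insert 0 ((P.filter (fun x => 0 ≤ x ∧ x < e)).image (fun x : ℕ => (x : ZMod e))) := by
    intro y hy
    rw [Finset.mem_add] at hy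
    obtain ⟨a, ha, b, hb, rfl⟩ := hy
    rw [hA, Finset.mem_image] at ha hb
    obtain ⟨a, ha, rfl⟩ := ha
    obtain ⟨b, hb, rfl⟩ := hb
    rw [Finset.mem_insert, ← Nat.cast_add]
    rcases hsum a ha b hb with h0 | h0
    · left; simp [h0]
    · right
      obtain ⟨y', hy', h1, h2, c, hc⟩ := descend P e h.he h.Pdown 1 le_rfl _ _ h0 rfl (h.P1 _ h0).1
      rw [Finset.mem_image]
      refine ⟨y', ?_, ?_⟩
      · rw [Finset.mem_filter]
        refine ⟨hy', Nat.zero_le _, ?_⟩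
        have : y' ≠ e := fun hh => h.eP (hh ▸ hy')
        omega
      · rw [hc]; simp
  have h3 := Finset.card_le_card hsub
  have h4 := Finset.card_insert_le (0 : ZMod e) ((P.filter (fun x => 0 ≤ x ∧ x < e)).image (fun x : ℕ => (x : ZMod e)))
  have h5 : ((P.filter (fun x => 0 ≤ x ∧ x < e)).image (fun x : ℕ => (x : ZMod e))).card ≤ cnt P 0 e := Finset.card_image_le
  omega

theorem I2 (h : CombHyp N e S P) (θ θ' : ℕ) (h1 : 1 ≤ θ) (h2 : θ ≤ N - e) (h3 : 1 ≤ θ') (h4 : N - e + 1 ≤ θ + θ') :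
    cnt S θ (θ + e) + cnt S θ' (θ' + e) ≤ cnt P θ (θ + e) := by
  classical
  have heN := h.heN
  have he := h.he
  set A0 : Finset (ZMod e) := (S.filter (fun x => θ ≤ x ∧ x < θ + e)).image (fun x : ℕ => (x : ZMod e)) with hA0
  set A := A0.image (fun x => x - (N : ZMod e)) with hA
  set B0 : Finset (ZMod e) := (S.filter (fun x => θ' ≤ x ∧ x < θ' + e)).image (fun x : ℕ => (x : ZMod e)) with hB0
  set B := insert 0 B0 with hB
  set C : Finset (ZMod e) := (P.filter (fun x => θ ≤ x ∧ x < θ + e)).image (fun x : ℕ => (x : ZMod e)) with hC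
  have cA : A.card = cnt S θ (θ + e) := by
    rw [hA, Finset.card_image_of_injective _ (sub_left_injective), hA0, card_window]
  have cC : C.card = cnt P θ (θ + e) := card_window _ _ _
  have h0B : (0 : ZMod e) ∉ B0 := by
    intro h0
    rw [hB0, Finset.mem_image] at h0
    obtain ⟨a, ha, ha0⟩ := h0
    rw [ZMod.natCast_eq_zero_iff] at ha0
    exact h.Pndvd (h.SP (Finset.mem_filter.1 ha).1) ha0
  have cB : B.card = cnt S θ' (θ' + e) + 1 := by
    rw [hB, Finset.card_insert_of_notMem h0B, hB0, card_window]
  have h0A : (0 : ZMod e) ∈ A := by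
    obtain ⟨y', hy', q1, q2, c, hc⟩ := descend S e h.he h.Sdown θ h1 _ _ h.hxS rfl h2
    rw [hA, Finset.mem_image]
    refine ⟨(y' : ZMod e), ?_, ?_⟩
    · rw [hA0, Finset.mem_image]; exact ⟨y', Finset.mem_filter.2 ⟨hy', q1, q2⟩, rfl⟩
    · rw [show N = y' + c * e + e by omega]; simp
  have key := scherk B.card A B rfl h0A (by simp [hB]) (by
    intro a ha b hb hab
    rw [hB, Finset.mem_insert] at hb
    rcases hb with hb | hb
    · exact hb
    exfalso
    rw [hA, Finset.mem_image] at ha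
    obtain ⟨a', ha', rfl⟩ := ha
    rw [hA0, Finset.mem_image] at ha'
    obtain ⟨a, ha, rfl⟩ := ha'
    rw [hB0, Finset.mem_image] at hb
    obtain ⟨b, hb, rfl⟩ := hb
    rw [Finset.mem_filter] at ha hb
    have hab' : ((a + b : ℕ) : ZMod e) = (N : ℕ) := by
      push_cast; linear_combination hab
    rw [ZMod.natCast_eq_natCast_iff] at hab'
    have hne := h.SSN a ha.1 b hb.1
    rcases lt_or_gt_of_ne hne with hlt | hgt
    · have := (Nat.modEq_iff_dvd' hlt.le).1 hab'
      have := Nat.le_of_dvd (by omega) this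
      omega
    · have hd := (Nat.modEq_iff_dvd' hgt.le).1 hab'.symm
      exact h.Pndvd (h.SP (h.SSS a ha.1 b hb.1 hgt)) hd)
  open Pointwise in
  have hsub : (A + B).image (fun x => x + (N : ZMod e)) ⊆ C := by
    intro y hy
    rw [Finset.mem_image] at hy
    obtain ⟨y, hy, rfl⟩ := hy
    rw [Finset.mem_add] at hy
    obtain ⟨a, ha, b, hb, rfl⟩ := hy
    rw [hA, Finset.mem_image] at ha
    obtain ⟨a', ha', rfl⟩ := ha
    rw [hA0, Finset.mem_image] at ha'
    obtain ⟨a, ha, rfl⟩ := ha'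
    rw [Finset.mem_filter] at ha
    rw [hB, Finset.mem_insert] at hb
    have main : ∃ y ∈ P, θ ≤ y ∧ (y : ZMod e) = (a : ZMod e) - N + b + N := by
      rcases hb with rfl | hb
      · exact ⟨a, h.SP ha.1, ha.2.1, by ring⟩
      · rw [hB0, Finset.mem_image] at hb
        obtain ⟨b, hb, rfl⟩ := hb
        rw [Finset.mem_filter] at hb
        obtain ⟨b', hb', q1, q2, c, hc⟩ := descend S e h.he h.Sdown 1 le_rfl _ _ hb.1 rfl (h.S1 _ hb.1).1
        have : b' ≠ e := fun hh => h.eP (hh ▸ h.SP hb')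
        have hm := h.hmax a ha.1
        refine ⟨a + b', h.SSP a ha.1 b' hb' (by omega), by omega, ?_⟩
        rw [hc]; push_cast; simp; ring
    obtain ⟨y, hyP, hθy, hyeq⟩ := main
    rw [← hyeq]
    obtain ⟨y', hy', q1, q2, c, hc⟩ := descend P e h.he h.Pdown θ h1 _ _ hyP rfl hθy
    rw [hC, Finset.mem_image]
    refine ⟨y', Finset.mem_filter.2 ⟨hy', q1, q2⟩, ?_⟩
    rw [hc]; simp
  have h5 := Finset.card_le_card hsub
  rw [Finset.card_image_of_injective _ (add_left_injective _)] at h5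
  omega

end CombHyp

theorem CombHyp.C1 {N e : ℕ} {S P : Finset ℕ} (h : CombHyp N e S P) (M r : ℕ) (hN : N = M * e + r) (hr : r < e) :
    ∀ n, n + 1 ≤ M → cnt S e ((n + 1) * e) + cnt S (N - e + 1 - n * e) (N - e + 1) ≤ cnt P e ((n + 1) * e) := by
  intro n
  have he := h.he
  induction n with
  | zero =>
    intro _
    have z1 : ∀ Q : Finset ℕ, ∀ a, cnt Q a a = 0 := by
      intro Q a; unfold cnt; rw [Finset.card_eq_zero, Finset.filter_eq_empty_iff]; intro x _ hx; omega
    simp [z1]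
  | succ n ih =>
    intro hn
    have ih := ih (by omega)
    have hle : (n + 1 + 1) * e ≤ M * e := Nat.mul_le_mul_right _ hn
    have e1 : (n + 1 + 1) * e = (n + 1) * e + e := by ring
    have e2 : (n + 1) * e = n * e + e := by ring
    have key := h.I2 ((n + 1) * e) (N - e + 1 - (n + 1) * e) (by omega) (by omega) (by omega) (by omega)
    have a1 := cnt_add S (a := e) (b := (n + 1) * e) (c := (n + 1 + 1) * e) (by omega) (by omega)
    have a2 := cnt_add P (a := e) (b := (n + 1) * e) (c := (n + 1 + 1) * e) (by omega) (by omega)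
    have a3 := cnt_add S (a := N - e + 1 - (n + 1) * e) (b := N - e + 1 - n * e) (c := N - e + 1) (by omega) (by omega)
    rw [show N - e + 1 - (n + 1) * e + e = N - e + 1 - n * e by omega] at key
    rw [e1] at *
    omega

theorem CombHyp.final {N e : ℕ} {S P : Finset ℕ} (h : CombHyp N e S P) (hc : P.card = 2 * S.card) :
    S = (Finset.range S.card).image (fun j => N - (j + 1) * e) := by
  classical
  have he := h.he
  have heN := h.heN
  obtain ⟨M, r, hN, hr⟩ : ∃ M r, N = M * e + r ∧ r < e :=
    ⟨N / e, N % e, by rw [mul_comm]; exact (Nat.div_add_mod N e).symm, Nat.mod_lt _ he⟩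
  have hM : 2 ≤ M := by
    by_contra hM
    have : M * e ≤ 1 * e := Nat.mul_le_mul_right _ (by omega)
    omega
  obtain ⟨m, rfl⟩ : ∃ m, M = m + 1 + 1 := ⟨M - 2, by omega⟩
  have eM : (m + 1 + 1) * e = (m + 1) * e + e := by ring
  have hx : N - e = (m + 1) * e + r := by omega
  have hr0 : 0 < r := by
    rcases Nat.eq_zero_or_pos r with h0 | h0
    · exfalso
      have := h.hxS
      rw [hx, h0] at this
      exact h.Smult _ this
    · exact h0
  -- the elements r + t e
  have hrt : ∀ t, t ≤ m + 1 → t * e + r ∈ S := by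
    intro t ht
    obtain ⟨s, hs⟩ : ∃ s, m + 1 = t + s := ⟨m + 1 - t, by omega⟩
    have : ∀ s t, m + 1 = t + s → t * e + r ∈ S := by
      intro s
      induction s with
      | zero => intro t ht; rw [show t = m + 1 by omega, ← hx]; exact h.hxS
      | succ s ihs =>
        intro t ht
        have := h.Sdown _ (ihs (t + 1) (by omega)) (by rw [add_mul]; omega)
        convert this using 1
        rw [add_mul]; omega
    exact this s t hs
  have hrS : r ∈ S := by simpa using hrt 0 (by omega)
  have hSlt : ∀ a ∈ S, a < (m + 1 + 1) * e := by
    intro a ha; have := h.hmax a ha; omega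
  have c1 := h.C1 (m + 1 + 1) r hN hr (m + 1) le_rfl
  have i1 := h.I1
  have s0 := cnt_all S (b := (m + 1 + 1) * e) hSlt
  have s0' := cnt_all S (b := N - e + 1) (fun a ha => by have := h.hmax a ha; omega)
  have p0 := cnt_all P (b := N) (fun a ha => (h.P1 a ha).2)
  have s1 := cnt_add S (a := 0) (b := e) (c := (m + 1 + 1) * e) (by omega) (by rw [eM]; omega)
  have p1 := cnt_add P (a := 0) (b := e) (c := (m + 1 + 1) * e) (by omega) (by rw [eM]; omega)
  have p2 := cnt_add P (a := 0) (b := (m + 1 + 1) * e) (c := N) (by omega) (by omega)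
  rw [show N - e + 1 - (m + 1) * e = r + 1 by omega] at c1
  have s2 := cnt_add S (a := 0) (b := r + 1) (c := N - e + 1) (by omega) (by omega)
  have s3 := cnt_add S (a := 0) (b := r + 1) (c := e) (by omega) (by omega)
  have hA : cnt S (r + 1) e = 0 := by omega
  have hB : cnt P ((m + 1 + 1) * e) N = 0 := by omega
  have hRle : ∀ a ∈ S, a < e → a ≤ r := by
    intro a ha hae
    by_contra hcon
    have := cnt_eq_zero S hA a ha (by omega)
    omega
  have hPlt : ∀ a ∈ P, a < (m + 1 + 1) * e := by
    intro a ha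
    by_contra hcon
    have := cnt_eq_zero P hB a ha (by omega)
    have := (h.P1 a ha).2
    omega
  have h2r : 2 * r < e := by
    have := hPlt _ (h.SSP _ h.hxS _ hrS (by omega))
    omega
  -- windows
  set ρ := cnt S 0 e with hρ
  set R := S.filter (fun x => 0 ≤ x ∧ x < e) with hR
  set R' := insert 0 R with hR'
  have hRc : R.card = ρ := rfl
  have h0R : 0 ∉ R := by
    intro h0
    have := h.S1 0 (Finset.mem_filter.1 h0).1
    omega
  have hR'c : R'.card = ρ + 1 := by rw [hR', Finset.card_insert_of_notMem h0R, hRc]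
  have hR'r : ∀ a ∈ R', a ≤ r := by
    intro a ha
    rw [hR', Finset.mem_insert] at ha
    rcases ha with rfl | ha
    · omega
    · have := Finset.mem_filter.1 ha; exact hRle a this.1 this.2.2
  -- reduce
  have hred : ∀ t, ∀ a ∈ S, t * e ≤ a → a < (t + 1) * e → a - t * e ∈ R := by
    intro t
    induction t with
    | zero => intro a ha h1 h2; rw [hR, Finset.mem_filter]; simp at h2 ⊢; exact ⟨ha, h2⟩
    | succ t ih =>
      intro a ha h1 h2
      have hne : a ≠ (t + 1) * e := fun hh => h.Smult _ (hh ▸ ha)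
      have e1 : (t + 1) * e = t * e + e := by ring
      have e2 : (t + 1 + 1) * e = t * e + e + e := by ring
      have := ih (a - e) (h.Sdown a ha (by omega)) (by omega) (by omega)
      convert this using 1
      omega
  set W : ℕ → Finset ℕ := fun t => S.filter (fun x => t * e ≤ x ∧ x < (t + 1) * e) with hW
  have hWsub : ∀ t, (W t) ⊆ R.image (fun x => x + t * e) := by
    intro t a ha
    rw [hW, Finset.mem_filter] at ha
    rw [Finset.mem_image]
    exact ⟨a - t * e, hred t a ha.1 ha.2.1 ha.2.2, by omega⟩
  have hRim : ∀ t, (R.image (fun x => x + t * e)).card = ρ := by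
    intro t; rw [Finset.card_image_of_injective _ (add_left_injective _), hRc]
  have hWle : ∀ t, cnt S (t * e) ((t + 1) * e) ≤ ρ := by
    intro t
    have := Finset.card_le_card (hWsub t)
    rw [hRim] at this
    exact this
  open Pointwise in
  have hWsum : ∀ t, (W t + R') ⊆ P.filter (fun x => t * e ≤ x ∧ x < (t + 1) * e) := by
    intro t y hy
    rw [Finset.mem_add] at hy
    obtain ⟨a, ha, b, hb, rfl⟩ := hy
    rw [hW, Finset.mem_filter] at ha
    have hbr := hR'r b hb
    have h1 := hred t a ha.1 ha.2.1 ha.2.2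
    have h2 := hR'r _ (Finset.mem_insert_of_mem h1)
    have e1 : (t + 1) * e = t * e + e := by ring
    have h3 := h.hmax a ha.1
    rw [Finset.mem_filter]
    refine ⟨?_, by omega, by omega⟩
    rw [hR', Finset.mem_insert] at hb
    rcases hb with rfl | hb
    · exact h.SP (by simpa using ha.1)
    · exact h.SSP a ha.1 b (Finset.mem_filter.1 hb).1 (by omega)
  have hPge : ∀ t ∈ Finset.range (m + 1 + 1), cnt S (t * e) ((t + 1) * e) + ρ ≤ cnt P (t * e) ((t + 1) * e) := by
    intro t ht
    rw [Finset.mem_range] at ht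
    have h1 := Finset.card_le_card (hWsum t)
    have hWne : (W t).Nonempty := by
      refine ⟨t * e + r, ?_⟩
      rw [hW, Finset.mem_filter]
      refine ⟨hrt t (by omega), by omega, ?_⟩
      rw [add_mul]; omega
    have h2 := cauchy_davenport_add_of_linearOrder_isCancelAdd hWne (⟨0, by simp [hR']⟩ : R'.Nonempty)
    rw [hR'c] at h2
    have h3 : (W t).card = cnt S (t * e) ((t + 1) * e) := rfl
    have h4 : (P.filter (fun x => t * e ≤ x ∧ x < (t + 1) * e)).card = cnt P (t * e) ((t + 1) * e) := rfl
    omega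
  have sumS := cnt_sum S e (m + 1 + 1)
  have sumP := cnt_sum P e (m + 1 + 1)
  have q1 := Finset.sum_le_sum hPge
  rw [Finset.sum_add_distrib, sumS, sumP, Finset.sum_const, Finset.card_range, smul_eq_mul] at q1
  have q2 : ∑ t ∈ Finset.range (m + 1 + 1), cnt S (t * e) ((t + 1) * e) ≤ (m + 1 + 1) * ρ := by
    refine (Finset.sum_le_sum (fun t _ => hWle t)).trans ?_
    rw [Finset.sum_const, Finset.card_range, smul_eq_mul]
  have hk : S.card = (m + 1 + 1) * ρ := by
    rw [sumS] at q2
    omega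
  have eqS : ∀ t ∈ Finset.range (m + 1 + 1), cnt S (t * e) ((t + 1) * e) = ρ := by
    rw [← Finset.sum_eq_sum_iff_of_le (fun t _ => hWle t), sumS, Finset.sum_const, Finset.card_range, smul_eq_mul]
    omega
  have eqP : cnt P 0 e = 2 * ρ := by
    have : ∀ t ∈ Finset.range (m + 1 + 1), cnt S (t * e) ((t + 1) * e) + ρ = cnt P (t * e) ((t + 1) * e) := by
      rw [← Finset.sum_eq_sum_iff_of_le hPge, Finset.sum_add_distrib, sumS, sumP, Finset.sum_const, Finset.card_range, smul_eq_mul]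
      omega
    have h0 := this 0 (by simp)
    simp only [zero_mul, zero_add, one_mul] at h0
    omega
  have hWeq : ∀ t, t ≤ m + 1 → W t = R.image (fun x => x + t * e) := by
    intro t ht
    apply Finset.eq_of_subset_of_card_le (hWsub t)
    rw [hRim]
    exact (eqS t (by simp; omega)).ge
  have hRS : ∀ t, t ≤ m + 1 → ∀ a ∈ R, a + t * e ∈ S := by
    intro t ht a ha
    have : a + t * e ∈ W t := by rw [hWeq t ht]; exact Finset.mem_image_of_mem _ ha
    exact (Finset.mem_filter.1 this).1
  have hrR : r ∈ R := by rw [hR, Finset.mem_filter]; exact ⟨hrS, Nat.zero_le _, hr⟩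
  have hρ1 : 1 ≤ ρ := by rw [← hRc]; exact Finset.card_pos.2 ⟨r, hrR⟩
  have hρ : ρ = 1 := by
    by_contra hρne
    have hsub : R' + R' ⊆ insert 0 (P.filter (fun x => 0 ≤ x ∧ x < e)) := by
      intro y hy
      rw [Finset.mem_add] at hy
      obtain ⟨a, ha, b, hb, rfl⟩ := hy
      rw [hR', Finset.mem_insert] at ha
      rcases ha with rfl | ha
      · rw [zero_add]
        rw [hR', Finset.mem_insert] at hb
        rcases hb with rfl | hb
        · simp
        · apply Finset.mem_insert_of_mem
          rw [Finset.mem_filter] at hb ⊢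
          exact ⟨h.SP hb.1, hb.2⟩
      · apply Finset.mem_insert_of_mem
        have haW : a ∈ W 0 := by rw [hWeq 0 (by omega)]; simpa using ha
        simpa using hWsum 0 (Finset.add_mem_add haW hb)
    have h1 := Finset.card_le_card hsub
    have h2 := Finset.card_insert_le 0 (P.filter (fun x => 0 ≤ x ∧ x < e))
    have h3 : (P.filter (fun x => 0 ≤ x ∧ x < e)).card = cnt P 0 e := rfl
    obtain ⟨q, hq, hAP⟩ := ap_lemma R' (by simp [hR']) (by omega) (by omega)
    rw [hR'c] at hAP
    have hmem : ∀ j, 1 ≤ j → j ≤ ρ → j * q ∈ R := by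
      intro j hj1 hj
      have : j * q ∈ R' := by rw [hAP, Finset.mem_image]; exact ⟨j, by simp; omega, rfl⟩
      rw [hR', Finset.mem_insert] at this
      rcases this with h0 | h0
      · exfalso
        have := Nat.mul_pos (show 0 < j by omega) hq
        omega
      · exact h0
    have hrq : r = ρ * q := by
      have h4 : r ∈ R' := Finset.mem_insert_of_mem hrR
      rw [hAP, Finset.mem_image] at h4
      obtain ⟨j, hj, hjr⟩ := h4
      rw [Finset.mem_range] at hj
      have h5 := hR'r _ (Finset.mem_insert_of_mem (hmem ρ hρ1 le_rfl))
      have h6 : j * q ≤ ρ * q := Nat.mul_le_mul_right _ (by omega)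
      omega
    obtain ⟨s, hs⟩ : ∃ s, ρ = s + 1 := ⟨ρ - 1, by omega⟩
    have hm1 := hRS (m + 1) le_rfl _ (hmem s (by omega) (by omega))
    have hm2 := hRS 1 (by omega) _ (hmem 1 le_rfl hρ1)
    apply h.SSN _ hm1 _ hm2
    rw [hN, hrq, hs]
    ring
  rw [hk, hρ, mul_one]
  have hR1 : R = {r} := by
    rw [hρ] at hRc
    obtain ⟨a, ha⟩ := Finset.card_eq_one.1 hRc
    rw [ha] at hrR ⊢
    rw [Finset.mem_singleton] at hrR
    rw [hrR]
  ext a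
  rw [Finset.mem_image]
  constructor
  · intro ha
    obtain ⟨t, ht1, ht2⟩ : ∃ t, t * e ≤ a ∧ a < (t + 1) * e :=
      ⟨a / e, Nat.div_mul_le_self _ _, by rw [mul_comm]; exact Nat.lt_mul_div_succ a he⟩
    have htm : t ≤ m + 1 := by
      by_contra hcon
      have : (m + 1 + 1) * e ≤ t * e := Nat.mul_le_mul_right _ (by omega)
      have := hSlt a ha
      omega
    have h1 := hred t a ha ht1 ht2
    rw [hR1, Finset.mem_singleton] at h1
    refine ⟨m + 1 - t, by rw [Finset.mem_range]; omega, ?_⟩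
    obtain ⟨s, hs⟩ : ∃ s, m + 1 = t + s := ⟨m + 1 - t, by omega⟩
    rw [hs, show t + s - t = s by omega, hN, hs]
    have e1 : (t + s + 1) * e = t * e + (s + 1) * e := by ring
    omega
  · rintro ⟨j, hj, rfl⟩
    rw [Finset.mem_range] at hj
    obtain ⟨s, hs⟩ : ∃ s, m + 1 = j + s := ⟨m + 1 - j, by omega⟩
    have := hrt s (by omega)
    convert this using 1
    rw [hN, hs]
    have e1 : (j + s + 1) * e = s * e + (j + 1) * e := by ring
    omega

theorem comb_main (N : ℕ) (S P : Finset ℕ) (hS0 : 1 ≤ S.card) (hc : P.card = 2 * S.card)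
    (S1 : ∀ a ∈ S, 1 ≤ a ∧ a < N) (P1 : ∀ a ∈ P, 1 ≤ a ∧ a < N) (SP : S ⊆ P)
    (SSN : ∀ a ∈ S, ∀ b ∈ S, a + b ≠ N)
    (SSP : ∀ a ∈ S, ∀ b ∈ S, a + b < N → a + b ∈ P)
    (SSS : ∀ a ∈ S, ∀ b ∈ S, N < a + b → a + b - N ∈ S)
    (PSN : ∀ a ∈ P, ∀ b ∈ S, a + b ≠ N)
    (PSP : ∀ a ∈ P, ∀ b ∈ S, N < a + b → a + b - N ∈ P) :
    ∃ z ∈ S, S = (Finset.range S.card).image (fun j => (j + 1) * z % N) := by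
  classical
  have hne : S.Nonempty := Finset.card_pos.1 hS0
  obtain ⟨x, hxS, hmax⟩ : ∃ m ∈ S, ∀ a ∈ S, a ≤ m := ⟨S.max' hne, S.max'_mem hne, fun a ha => S.le_max' a ha⟩
  have hx1 := S1 x hxS
  have hxx := SSN x hxS x hxS
  by_cases hlt : 2 * x < N
  · -- arithmetic progression case
    have h0S : 0 ∉ S := fun h0 => by have := S1 0 h0; omega
    have h0P : 0 ∉ P := fun h0 => by have := P1 0 h0; omega
    open Pointwise in
    have hsub : insert 0 S + insert 0 S ⊆ insert 0 P := by
      intro y hy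
      rw [Finset.mem_add] at hy
      obtain ⟨a, ha, b, hb, rfl⟩ := hy
      rw [Finset.mem_insert] at ha hb
      rcases ha with rfl | ha
      · rcases hb with rfl | hb
        · simp
        · rw [zero_add]; exact Finset.mem_insert_of_mem (SP hb)
      · rcases hb with rfl | hb
        · rw [add_zero]; exact Finset.mem_insert_of_mem (SP ha)
        · apply Finset.mem_insert_of_mem
          have h1 := hmax a ha
          have h2 := hmax b hb
          exact SSP a ha b hb (by omega)
    have h1 := Finset.card_le_card hsub
    have h2 := Finset.card_insert_of_notMem h0P
    have h3 := Finset.card_insert_of_notMem h0S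
    obtain ⟨q, hq, hAP⟩ := ap_lemma (insert 0 S) (by simp) (by omega) (by omega)
    rw [h3] at hAP
    have hmem : ∀ j, j < S.card → (j + 1) * q ∈ S := by
      intro j hj
      have : (j + 1) * q ∈ insert 0 S := by
        rw [hAP, Finset.mem_image]; exact ⟨j + 1, by simp; omega, rfl⟩
      rw [Finset.mem_insert] at this
      rcases this with h0 | h0
      · have := Nat.mul_pos (show 0 < j + 1 by omega) hq
        omega
      · exact h0
    refine ⟨q, by simpa using hmem 0 (by omega), ?_⟩
    ext a
    rw [Finset.mem_image]
    constructor
    · intro ha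
      have h4 : a ∈ insert 0 S := Finset.mem_insert_of_mem ha
      rw [hAP, Finset.mem_image] at h4
      obtain ⟨j, hj, rfl⟩ := h4
      rw [Finset.mem_range] at hj
      rcases j with _ | j
      · exfalso; apply h0S; simpa using ha
      · exact ⟨j, by simp; omega, Nat.mod_eq_of_lt (S1 _ ha).2⟩
    · rintro ⟨j, hj, rfl⟩
      rw [Finset.mem_range] at hj
      have := hmem j hj
      rw [Nat.mod_eq_of_lt (S1 _ this).2]
      exact this
  · obtain ⟨e, he⟩ : ∃ e, N = x + e := ⟨N - x, by omega⟩
    have hyp : CombHyp N e S P := ⟨by omega, by omega, by rw [he]; simpa using hxS,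
      by rw [he]; simpa using hmax, S1, P1, SP, SSN, SSP, SSS, PSN, PSP⟩
    have hfin := hyp.final hc
    refine ⟨x, hxS, ?_⟩
    have hj : ∀ j ∈ Finset.range S.card, N - (j + 1) * e = (j + 1) * x % N := by
      intro j hj
      have hm : N - (j + 1) * e ∈ S := by rw [hfin]; exact Finset.mem_image_of_mem _ hj
      have h1 := S1 _ hm
      have h2 : (j + 1) * e + (N - (j + 1) * e) = N := by omega
      rw [← Nat.mod_eq_of_lt h1.2]
      change _ ≡ _ [MOD N]
      apply Nat.ModEq.add_left_cancel' ((j + 1) * e)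
      rw [h2, ← mul_add, show e + x = N by omega]
      exact ((Nat.modEq_zero_iff_dvd.2 (dvd_refl N)).trans (Nat.modEq_zero_iff_dvd.2 (dvd_mul_left N _)).symm)
    conv_lhs => rw [hfin]
    exact Finset.image_congr hj

theorem weights (d k : ℕ) (hd : 2 ≤ d) (hk : 1 ≤ k) (β : Fin (d + 1) → ℝ) (hpos : ∀ i, 0 < β i)
    (hlt : ∀ i, β i < 1)
    (hint : ∀ i, ∃ m : ℤ, ((d * k + 1 : ℕ) : ℝ) * β i = m)
    (hfl : ∀ s, s < k → ∀ j, 1 ≤ j → j ≤ d → ∑ i, ⌊((d * s + j : ℕ) : ℝ) * β i⌋ = d * s) :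
    ∃ i0, ∀ i, i ≠ i0 → ((d * k + 1 : ℕ) : ℝ) * β i = k := by
  have hmono : ∀ (a b : ℕ) i, a ≤ b → ⌊(a : ℝ) * β i⌋ ≤ ⌊(b : ℝ) * β i⌋ := by
    intro a b i hab
    apply Int.floor_le_floor
    exact mul_le_mul_of_nonneg_right (by exact_mod_cast hab) (hpos i).le
  have hnn : ∀ (a : ℕ) i, 0 ≤ ⌊(a : ℝ) * β i⌋ := fun a i =>
    Int.floor_nonneg.2 (mul_nonneg (Nat.cast_nonneg _) (hpos i).le)
  have h0 : ∀ i, ⌊(d : ℝ) * β i⌋ = 0 := by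
    have := hfl 0 (by omega) d (by omega) le_rfl
    simp only [mul_zero, zero_add] at this
    have h := (Finset.sum_eq_zero_iff_of_nonneg (fun i _ => hnn d i)).1 (by simpa using this)
    intro i; exact h i (Finset.mem_univ _)
  have hdlt : ∀ i, (d : ℝ) * β i < 1 := by
    intro i
    have := Int.lt_floor_add_one ((d : ℝ) * β i)
    rw [h0 i] at this; simpa using this
  -- final step
  have hfinal : ∀ i, ((k - 1 : ℕ) : ℤ) = ⌊((d * k : ℕ) : ℝ) * β i⌋ → ((d * k + 1 : ℕ) : ℝ) * β i = k := by
    intro i hi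
    obtain ⟨m, hm⟩ := hint i
    have h1 := Int.lt_floor_add_one (((d * k : ℕ) : ℝ) * β i)
    have h2 := Int.floor_le (((d * k : ℕ) : ℝ) * β i)
    rw [← hi] at h1 h2
    have h3 := hpos i
    have h4 := hlt i
    have hk' : ((k - 1 : ℕ) : ℝ) = k - 1 := by rw [Nat.cast_sub hk]; simp
    rw [Int.cast_natCast, hk'] at h1 h2
    have h5 : ((d * k + 1 : ℕ) : ℝ) * β i = ((d * k : ℕ) : ℝ) * β i + β i := by push_cast; ring
    have h6 : (m : ℝ) < k + 1 := by rw [← hm, h5]; linarith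
    have h7 : (k : ℝ) - 1 < m := by rw [← hm, h5]; linarith
    have h6' : m < k + 1 := by exact_mod_cast h6
    have h7' : (k : ℤ) - 1 < m := by exact_mod_cast h7
    have : m = k := by omega
    rw [hm, this]; simp
  rcases Nat.lt_or_ge k 2 with hk2 | hk2
  · have hk1 : k = 1 := by omega
    subst hk1
    refine ⟨0, fun i _ => hfinal i ?_⟩
    simp [h0]
  · have h1 := hfl 1 (by omega) 1 le_rfl (by omega)
    simp only [mul_one] at h1
    have hle1 : ∀ i, ⌊((d + 1 : ℕ) : ℝ) * β i⌋ ≤ 1 := by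
      intro i
      have : ⌊((d + 1 : ℕ) : ℝ) * β i⌋ < 2 := by
        rw [Int.floor_lt]; push_cast; have := hdlt i; have := hlt i; linarith
      omega
    have hex : ∃ i0, ⌊((d + 1 : ℕ) : ℝ) * β i0⌋ = 0 := by
      by_contra! hcon
      have : ∑ i : Fin (d + 1), (1 : ℤ) ≤ ∑ i, ⌊((d + 1 : ℕ) : ℝ) * β i⌋ := by
        apply Finset.sum_le_sum
        intro i _
        have := hcon i
        have := hnn (d + 1) i
        omega
      rw [h1] at this
      simp at this
    obtain ⟨i0, hi0⟩ := hex
    refine ⟨i0, ?_⟩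
    have hcard : ((Finset.univ : Finset (Fin (d + 1))).erase i0).card = d := by
      rw [Finset.card_erase_of_mem (Finset.mem_univ _)]; simp
    have hone : ∀ i, i ≠ i0 → 1 ≤ ((d + 1 : ℕ) : ℝ) * β i := by
      have e1 := Finset.add_sum_erase Finset.univ (fun i => ⌊((d + 1 : ℕ) : ℝ) * β i⌋) (Finset.mem_univ i0)
      have e2 : ∑ i ∈ Finset.univ.erase i0, ⌊((d + 1 : ℕ) : ℝ) * β i⌋ = ∑ i ∈ Finset.univ.erase i0, (1 : ℤ) := by
        rw [Finset.sum_const, hcard]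
        simp only [hi0, h1] at e1
        rw [nsmul_eq_mul]; push_cast at e1 ⊢; linarith
      have e3 := (Finset.sum_eq_sum_iff_of_le (fun i _ => hle1 i)).1 e2
      intro i hi
      have := e3 i (Finset.mem_erase.2 ⟨hi, Finset.mem_univ _⟩)
      have h2 := Int.floor_le (((d + 1 : ℕ) : ℝ) * β i)
      rw [this] at h2; simpa using h2
    have hge : ∀ s, s < k → ∀ i, i ≠ i0 → (s : ℤ) ≤ ⌊((d * s + 1 : ℕ) : ℝ) * β i⌋ := by
      intro s
      induction s with
      | zero => intro _ i _; simpa using hnn 1 i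
      | succ s ih =>
        intro hs i hi
        have ih := ih (by omega) i hi
        have hc : ⌊((d * (s + 1) + 1 : ℕ) : ℝ) * β i⌋ = ⌊((d * (s + 1) + 2 : ℕ) : ℝ) * β i⌋ := by
          have g1 := hfl (s + 1) hs 1 le_rfl (by omega)
          have g2 := hfl (s + 1) hs 2 (by omega) hd
          have := (Finset.sum_eq_sum_iff_of_le (s := Finset.univ) (fun i _ => hmono (d * (s + 1) + 1) (d * (s + 1) + 2) i (by omega))).1 (g1.trans g2.symm)
          exact this i (Finset.mem_univ _)
        rw [hc, Int.le_floor]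
        rw [Int.le_floor] at ih
        have := hone i hi
        push_cast at this ih ⊢
        linarith
    intro i hi
    apply hfinal
    have hsum := hfl (k - 1) (by omega) d (by omega) le_rfl
    rw [show d * (k - 1) + d = d * k by rw [← Nat.mul_succ]; congr 1; omega] at hsum
    have hge' : ∀ i ∈ Finset.univ.erase i0, ((k - 1 : ℕ) : ℤ) ≤ ⌊((d * k : ℕ) : ℝ) * β i⌋ := by
      intro i hi
      refine (hge (k - 1) (by omega) i (Finset.ne_of_mem_erase hi)).trans (hmono _ _ i ?_)
      obtain ⟨k', rfl⟩ : ∃ k', k = k' + 1 := ⟨k - 1, by omega⟩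
      simp only [Nat.add_sub_cancel, Nat.mul_succ]; omega
    have e1 := Finset.add_sum_erase Finset.univ (fun i => ⌊((d * k : ℕ) : ℝ) * β i⌋) (Finset.mem_univ i0)
    have e2 := Finset.sum_le_sum hge'
    have e3 := hnn (d * k) i0
    have e4 : ∑ i ∈ Finset.univ.erase i0, ((k - 1 : ℕ) : ℤ) = ∑ i ∈ Finset.univ.erase i0, ⌊((d * k : ℕ) : ℝ) * β i⌋ := by
      apply le_antisymm e2
      rw [Finset.sum_const, hcard, nsmul_eq_mul]
      rw [hsum] at e1
      linarith
    exact (Finset.sum_eq_sum_iff_of_le hge').1 e4 i (Finset.mem_erase.2 ⟨hi, Finset.mem_univ _⟩)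

structure GHyp (G : Type*) [AddCommGroup G] [Fintype G] (d k : ℕ) (b : G → Fin (d + 1) → ℝ) (h : G → ℕ) : Prop where
  hd : 3 ≤ d
  hk : 1 ≤ k
  b0 : ∀ g i, 0 ≤ b g i
  b1 : ∀ g i, b g i < 1
  badd : ∀ g g' i, b (g + g') i = Int.fract (b g i + b g' i)
  binj : ∀ g, (∀ i, b g i = 0) → g = 0
  hsum : ∀ g, ∑ i, b g i = h g
  card : Fintype.card G = d * k + 1
  cardI : {g : G | h g = 1}.ncard = k
  pos : ∀ g, h g = 1 → ∀ i, 0 < b g i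

namespace GHyp
variable {G : Type*} [AddCommGroup G] [Fintype G] {d k : ℕ} {b : G → Fin (d + 1) → ℝ} {h : G → ℕ}

theorem bcases (H : GHyp G d k b h) (g g' : G) (i) :
    (b g i + b g' i < 1 ∧ b (g + g') i = b g i + b g' i) ∨ (1 ≤ b g i + b g' i ∧ b (g + g') i = b g i + b g' i - 1) := by
  have h1 := H.b0 g i
  have h2 := H.b0 g' i
  have h3 := H.b1 g i
  have h4 := H.b1 g' i
  rw [H.badd]
  by_cases hlt : b g i + b g' i < 1
  · left; exact ⟨hlt, Int.fract_eq_self.2 ⟨by linarith, hlt⟩⟩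
  · right
    push Not at hlt
    refine ⟨hlt, ?_⟩
    rw [Int.fract_eq_iff]
    exact ⟨by linarith, by linarith, 1, by push_cast; ring⟩

theorem bzero (H : GHyp G d k b h) (i) : b 0 i = 0 := by
  have h1 := H.b1 0 i
  rcases H.bcases 0 0 i with ⟨_, h2⟩ | ⟨_, h2⟩
  · rw [add_zero] at h2; linarith
  · rw [add_zero] at h2; linarith

theorem hzero (H : GHyp G d k b h) : h 0 = 0 := by
  have := H.hsum 0
  simp only [H.bzero, Finset.sum_const_zero] at this
  exact_mod_cast this.symm

theorem eq_zero_of_h (H : GHyp G d k b h) {g : G} (hg : h g = 0) : g = 0 := by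
  apply H.binj
  have := H.hsum g
  rw [hg, Nat.cast_zero, Finset.sum_eq_zero_iff_of_nonneg (fun i _ => H.b0 g i)] at this
  exact fun i => this i (Finset.mem_univ _)

theorem bsub (H : GHyp G d k b h) (g g' : G) (i) : b (g + g') i ≤ b g i + b g' i := by
  rcases H.bcases g g' i with ⟨_, h2⟩ | ⟨_, h2⟩ <;> linarith

theorem hsub (H : GHyp G d k b h) (g g' : G) : h (g + g') ≤ h g + h g' := by
  have : (h (g + g') : ℝ) ≤ h g + h g' := by
    rw [← H.hsum, ← H.hsum, ← H.hsum, ← Finset.sum_add_distrib]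
    exact Finset.sum_le_sum (fun i _ => H.bsub g g' i)
  exact_mod_cast this

theorem hwrap (H : GHyp G d k b h) (g g' : G) (i) (hi : 1 ≤ b g i + b g' i) : h (g + g') + 1 ≤ h g + h g' := by
  by_contra hcon
  have heq : h (g + g') = h g + h g' := by have := H.hsub g g'; omega
  have h1 : (h (g + g') : ℝ) = h g + h g' := by exact_mod_cast heq
  rw [← H.hsum, ← H.hsum, ← H.hsum, ← Finset.sum_add_distrib,
    Finset.sum_eq_sum_iff_of_le (fun i _ => H.bsub g g' i)] at h1
  have h2 := h1 i (Finset.mem_univ _)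
  rcases H.bcases g g' i with ⟨h3, h4⟩ | ⟨h3, h4⟩ <;> linarith

theorem bneg (H : GHyp G d k b h) (g : G) (i) (hi : 0 < b g i) : b (-g) i = 1 - b g i := by
  have h0 := H.bzero i
  have h1 := H.b0 (-g) i
  rcases H.bcases g (-g) i with ⟨_, h2⟩ | ⟨_, h2⟩ <;> rw [add_neg_cancel, h0] at h2 <;> linarith

theorem hneg (H : GHyp G d k b h) (g : G) (hi : ∀ i, 0 < b g i) : h (-g) + h g = d + 1 := by
  have : (h (-g) : ℝ) + h g = d + 1 := by
    rw [← H.hsum, ← H.hsum, ← Finset.sum_add_distrib]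
    rw [Finset.sum_congr rfl (fun i _ => by rw [H.bneg g i (hi i)] : ∀ i ∈ Finset.univ, b (-g) i + b g i = 1 - b g i + b g i)]
    simp
  exact_mod_cast this

open Classical in
/-- sublevel sets of the height -/
noncomputable def lev (h : G → ℕ) (j : ℕ) : Finset G := Finset.univ.filter (fun g => h g ≤ j)

theorem mem_lev (j : ℕ) (g : G) : g ∈ lev h j ↔ h g ≤ j := by
  classical
  simp [lev]

open Classical in
open scoped Pointwise in
/-- iterated sumsets -/
noncomputable def iter (h : G → ℕ) : ℕ → Finset G
  | 0 => {0}
  | j + 1 => iter h j + lev h 1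

theorem iter_sub (H : GHyp G d k b h) (j : ℕ) : iter h j ⊆ lev h j := by
  induction j with
  | zero => intro g hg; simp [iter] at hg; rw [mem_lev, hg, H.hzero]
  | succ j ih =>
    classical
    intro g hg
    rw [iter, Finset.mem_add] at hg
    obtain ⟨a, ha, c, hc, rfl⟩ := hg
    have h1 := ih ha
    rw [mem_lev] at h1 hc ⊢
    have := H.hsub a c
    omega

theorem zero_iter (H : GHyp G d k b h) (j : ℕ) : (0 : G) ∈ iter h j := by
  induction j with
  | zero => simp [iter]
  | succ j ih =>
    classical
    rw [iter, Finset.mem_add]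
    exact ⟨0, ih, 0, by rw [mem_lev, H.hzero]; omega, by simp⟩

theorem card_lev1 (H : GHyp G d k b h) : (lev h 1).card = k + 1 := by
  classical
  have h1 : lev h 1 = insert 0 (Finset.univ.filter (fun g => h g = 1)) := by
    ext g
    rw [mem_lev, Finset.mem_insert, Finset.mem_filter]
    constructor
    · intro hg
      rcases Nat.eq_zero_or_pos (h g) with h0 | h0
      · left; exact H.eq_zero_of_h h0
      · right; exact ⟨Finset.mem_univ _, by omega⟩
    · rintro (rfl | hg)
      · rw [H.hzero]; omega
      · omega
  rw [h1, Finset.card_insert_of_notMem (by simp [H.hzero])]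
  congr 1
  rw [← H.cardI, ← Set.ncard_coe_finset]
  congr 1
  ext g; simp

open scoped Pointwise in
open Classical in
theorem scherk_step (H : GHyp G d k b h) (j : ℕ) (hj : j < d) (A : Finset G) (h0 : 0 ∈ A) (hA : A ⊆ lev h j) :
    A.card + k ≤ (A + lev h 1).card := by
  have h00 : (0 : G) ∈ lev h 1 := by rw [mem_lev, H.hzero]; omega
  have := scherk (lev h 1).card A (lev h 1) rfl h0 h00 (by
    intro a ha c hc hac
    by_contra hc0
    rw [mem_lev] at hc
    have h1 : h c = 1 := by
      rcases Nat.eq_zero_or_pos (h c) with hh | hh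
      · exact absurd (H.eq_zero_of_h hh) hc0
      · omega
    have h2 := H.hneg c (H.pos c h1)
    rw [← eq_neg_of_add_eq_zero_left hac] at h2
    have h3 := hA ha
    rw [mem_lev] at h3
    omega)
  rw [H.card_lev1] at this
  omega

theorem card_iter (H : GHyp G d k b h) (j : ℕ) (hj : j ≤ d) : j * k + 1 ≤ (iter h j).card := by
  induction j with
  | zero => simp [iter]
  | succ j ih =>
    have h1 := H.scherk_step j (by omega) (iter h j) (H.zero_iter j) (H.iter_sub j)
    have h2 := ih (by omega)
    rw [iter, add_mul]
    omega

theorem lev_succ (H : GHyp G d k b h) (j : ℕ) (hj : j < d) : (lev h j).card + k ≤ (lev h (j + 1)).card := by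
  classical
  have h1 := H.scherk_step j hj (lev h j) (by rw [mem_lev, H.hzero]; omega) (Finset.Subset.refl _)
  refine h1.trans (Finset.card_le_card ?_)
  intro g hg
  rw [Finset.mem_add] at hg
  obtain ⟨a, ha, c, hc, rfl⟩ := hg
  rw [mem_lev] at *
  have := H.hsub a c
  omega

theorem card_lev_le (H : GHyp G d k b h) (j : ℕ) (hj : j ≤ d) : (lev h j).card ≤ j * k + 1 := by
  have : ∀ n j, j + n = d → (lev h j).card + n * k ≤ d * k + 1 := by
    intro n
    induction n with
    | zero => intro j _; rw [← H.card]; simpa using Finset.card_le_univ _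
    | succ n ih =>
      intro j hj
      have h1 := ih (j + 1) (by omega)
      have h2 := H.lev_succ j (by omega)
      rw [add_mul]; omega
  obtain ⟨n, rfl⟩ : ∃ n, d = j + n := ⟨d - j, by omega⟩
  have := this n j rfl
  rw [add_mul] at this
  omega

theorem iter_eq (H : GHyp G d k b h) (j : ℕ) (hj : j ≤ d) : iter h j = lev h j :=
  Finset.eq_of_subset_of_card_le (H.iter_sub j) ((H.card_lev_le j hj).trans (H.card_iter j hj))

theorem card_lev (H : GHyp G d k b h) (j : ℕ) (hj : j ≤ d) : (lev h j).card = j * k + 1 :=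
  le_antisymm (H.card_lev_le j hj) (by rw [← H.iter_eq j hj]; exact H.card_iter j hj)

theorem iter_univ (H : GHyp G d k b h) (g : G) : g ∈ iter h d := by
  have : iter h d = Finset.univ := by
    apply Finset.eq_univ_of_card
    rw [H.iter_eq d le_rfl, H.card_lev d le_rfl, H.card]
  rw [this]; exact Finset.mem_univ _

theorem hle (H : GHyp G d k b h) (g : G) : h g ≤ d := by
  have := H.iter_sub d (H.iter_univ g)
  rwa [mem_lev] at this

theorem allpos (H : GHyp G d k b h) (g : G) (hg : g ≠ 0) (i) : 0 < b g i := by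
  classical
  obtain ⟨j, hj⟩ : ∃ j, h g = j + 1 := by
    refine ⟨h g - 1, ?_⟩
    have : h g ≠ 0 := fun h0 => hg (H.eq_zero_of_h h0)
    omega
  have hm : g ∈ iter h (j + 1) := by
    rw [H.iter_eq (j + 1) (by rw [← hj]; exact H.hle g), mem_lev]; omega
  rw [iter, Finset.mem_add] at hm
  obtain ⟨a, ha, c, hc, hac⟩ := hm
  have h1 := H.iter_sub j ha
  rw [mem_lev] at h1 hc
  have h2 := H.hsub a c
  rw [hac] at h2
  have h3 := H.pos c (by omega) i
  rcases H.bcases a c i with ⟨_, h4⟩ | ⟨h5, _⟩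
  · rw [hac] at h4; have := H.b0 a i; linarith
  · have := H.hwrap a c i h5
    rw [hac] at this
    omega

theorem bnsmul (H : GHyp G d k b h) (g : G) (i) (n : ℕ) : b (n • g) i = Int.fract ((n : ℝ) * b g i) := by
  induction n with
  | zero => simp [H.bzero]
  | succ n ih =>
    rw [succ_nsmul, H.badd, ih, Int.fract_eq_fract]
    refine ⟨-⌊(n : ℝ) * b g i⌋, ?_⟩
    rw [Int.fract]; push_cast; ring

theorem exc (H : GHyp G d k b h) (g : G) (i) : ∃ c : ℕ, ((d * k + 1 : ℕ) : ℝ) * b g i = c := by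
  have h1 := H.bnsmul g i (d * k + 1)
  rw [← H.card, card_nsmul_eq_zero, H.bzero] at h1
  rw [← H.card]
  obtain ⟨m, hm⟩ := Int.fract_eq_zero_iff.1 h1.symm
  have h2 : 0 ≤ m := by
    have : (0 : ℝ) ≤ m := by rw [hm]; exact mul_nonneg (Nat.cast_nonneg _) (H.b0 g i)
    exact_mod_cast this
  obtain ⟨c, rfl⟩ := Int.eq_ofNat_of_zero_le h2
  exact ⟨c, by rw [← hm]; simp⟩

theorem gen (H : GHyp G d k b h) : ∃ z : G, (∀ j, 1 ≤ j → j ≤ k → h (j • z) = 1) ∧ ∀ g, h g = 1 → g ∈ AddSubgroup.zmultiples z := by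
  classical
  have hd := H.hd
  have hN : (0 : ℝ) < ((d * k + 1 : ℕ) : ℝ) := by exact_mod_cast Nat.succ_pos _
  choose c hc using fun g => H.exc g 0
  set N := d * k + 1 with hNdef
  have clt : ∀ g, c g < N := by
    intro g
    have : (c g : ℝ) < N := by rw [← hc]; have := H.b1 g 0; nlinarith
    exact_mod_cast this
  have cpos : ∀ g, g ≠ 0 → 1 ≤ c g := by
    intro g hg
    have : (0 : ℝ) < c g := by rw [← hc]; exact mul_pos hN (H.allpos g hg 0)
    exact_mod_cast this
  have cadd : ∀ g g', (c g + c g' < N ∧ c (g + g') = c g + c g') ∨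
      (N ≤ c g + c g' ∧ c (g + g') + N = c g + c g' ∧ h (g + g') + 1 ≤ h g + h g') := by
    intro g g'
    rcases H.bcases g g' 0 with ⟨h1, h2⟩ | ⟨h1, h2⟩
    · left
      constructor
      · have : (c g : ℝ) + c g' < N := by rw [← hc, ← hc]; nlinarith
        exact_mod_cast this
      · have : (c (g + g') : ℝ) = c g + c g' := by rw [← hc, ← hc, ← hc, h2]; ring
        exact_mod_cast this
    · right
      refine ⟨?_, ?_, H.hwrap g g' 0 h1⟩
      · have : (N : ℝ) ≤ c g + c g' := by rw [← hc, ← hc]; nlinarith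
        exact_mod_cast this
      · have : (c (g + g') : ℝ) + N = c g + c g' := by rw [← hc, ← hc, ← hc, h2]; ring
        exact_mod_cast this
  have c0 : c 0 = 0 := by
    have : (c 0 : ℝ) = 0 := by rw [← hc, H.bzero]; simp
    exact_mod_cast this
  have cinj : Function.Injective c := by
    intro g g' hgg
    by_contra hne
    have h1 : g - g' ≠ 0 := sub_ne_zero.2 hne
    have h2 := cpos _ h1
    have h3 := clt (g - g')
    rcases cadd (g - g') g' with h4 | h4 <;> rw [sub_add_cancel] at h4 <;> omega
  have cmul : ∀ (g : G) (n : ℕ), c (n • g) = n * c g % N := by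
    intro g n
    induction n with
    | zero => simp [c0]
    | succ n ih =>
      rw [succ_nsmul, add_mul, one_mul, Nat.add_mod, ← ih, Nat.mod_eq_of_lt (clt g)]
      have h3 := clt (n • g + g)
      rcases cadd (n • g) g with h4 | h4
      · rw [h4.2, Nat.mod_eq_of_lt h4.1]
      · rw [← h4.2.1, Nat.add_mod_right, Nat.mod_eq_of_lt h3]
  set I : Finset G := Finset.univ.filter (fun g => h g = 1) with hI
  have Ic : I.card = k := by
    rw [← H.cardI, ← Set.ncard_coe_finset]; congr 1; ext g; simp [hI]
  have memI : ∀ g, g ∈ I ↔ h g = 1 := by intro g; simp [hI]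
  set Q : Finset G := (lev h 2).erase 0 with hQ
  have Qc : Q.card = 2 * k := by
    rw [hQ, Finset.card_erase_of_mem (by rw [mem_lev, H.hzero]; omega), H.card_lev 2 (by omega)]; omega
  have memQ : ∀ g, g ∈ Q ↔ g ≠ 0 ∧ h g ≤ 2 := by intro g; rw [hQ, Finset.mem_erase, mem_lev]
  have hne0 : ∀ g, h g = 1 → g ≠ 0 := by rintro g hg rfl; rw [H.hzero] at hg; omega
  have hsum0 : ∀ g g', h g' = 1 → g + g' = 0 → h g = d := by
    intro g g' h1 h2
    have h3 := H.hneg g' (H.pos g' h1)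
    rw [← eq_neg_of_add_eq_zero_left h2] at h3
    omega
  have ceq0 : ∀ g, c g = 0 → g = 0 := by intro g hg; exact cinj (by rw [hg, c0])
  obtain ⟨z, hz, hzS⟩ := comb_main N (I.image c) (Q.image c)
    (by rw [Finset.card_image_of_injective _ cinj, Ic]; exact H.hk)
    (by rw [Finset.card_image_of_injective _ cinj, Finset.card_image_of_injective _ cinj, Ic, Qc])
    (by
      intro a ha; rw [Finset.mem_image] at ha; obtain ⟨g, hg, rfl⟩ := ha
      exact ⟨cpos g (hne0 g ((memI g).1 hg)), clt g⟩)
    (by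
      intro a ha; rw [Finset.mem_image] at ha; obtain ⟨g, hg, rfl⟩ := ha
      exact ⟨cpos g ((memQ g).1 hg).1, clt g⟩)
    (by
      apply Finset.image_subset_image
      intro g hg; rw [memI] at hg; rw [memQ]; exact ⟨hne0 g hg, by omega⟩)
    (by
      intro a ha a' ha' hN'
      rw [Finset.mem_image] at ha ha'
      obtain ⟨g, hg, rfl⟩ := ha
      obtain ⟨g', hg', rfl⟩ := ha'
      rw [memI] at hg hg'
      have := hsum0 g g' hg' (by
        apply ceq0
        rcases cadd g g' with h4 | h4 <;> omega)
      omega)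
    (by
      intro a ha a' ha' hN'
      rw [Finset.mem_image] at ha ha'
      obtain ⟨g, hg, rfl⟩ := ha
      obtain ⟨g', hg', rfl⟩ := ha'
      rw [memI] at hg hg'
      rw [Finset.mem_image]
      rcases cadd g g' with h4 | h4
      · refine ⟨g + g', ?_, h4.2⟩
        rw [memQ]
        refine ⟨?_, by have := H.hsub g g'; omega⟩
        intro h0
        have := cpos g (hne0 g hg)
        rw [h0, c0] at h4; omega
      · omega)
    (by
      intro a ha a' ha' hN'
      rw [Finset.mem_image] at ha ha'
      obtain ⟨g, hg, rfl⟩ := ha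
      obtain ⟨g', hg', rfl⟩ := ha'
      rw [memI] at hg hg'
      rw [Finset.mem_image]
      rcases cadd g g' with h4 | h4
      · omega
      · refine ⟨g + g', ?_, by omega⟩
        rw [memI]
        have : h (g + g') ≠ 0 := by
          intro h0
          have := H.eq_zero_of_h h0
          rw [this, c0] at h4; omega
        omega)
    (by
      intro a ha a' ha' hN'
      rw [Finset.mem_image] at ha ha'
      obtain ⟨g, hg, rfl⟩ := ha
      obtain ⟨g', hg', rfl⟩ := ha'
      rw [memI] at hg'
      rw [memQ] at hg
      have := hsum0 g g' hg' (by
        apply ceq0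
        rcases cadd g g' with h4 | h4 <;> omega)
      omega)
    (by
      intro a ha a' ha' hN'
      rw [Finset.mem_image] at ha ha'
      obtain ⟨g, hg, rfl⟩ := ha
      obtain ⟨g', hg', rfl⟩ := ha'
      rw [memI] at hg'
      rw [memQ] at hg
      rw [Finset.mem_image]
      rcases cadd g g' with h4 | h4
      · omega
      · refine ⟨g + g', ?_, by omega⟩
        rw [memQ]
        refine ⟨?_, by omega⟩
        intro h0
        rw [h0, c0] at h4; omega)
  rw [Finset.card_image_of_injective _ cinj, Ic] at hzS
  rw [Finset.mem_image] at hz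
  obtain ⟨z, hz, rfl⟩ := hz
  refine ⟨z, ?_, ?_⟩
  · intro j hj1 hj2
    have : j * c z % N ∈ I.image c := by
      rw [hzS, Finset.mem_image]
      exact ⟨j - 1, by rw [Finset.mem_range]; omega, by rw [show j - 1 + 1 = j by omega]⟩
    rw [← cmul, Finset.mem_image] at this
    obtain ⟨g, hg, hgc⟩ := this
    rw [← cinj hgc]
    exact (memI g).1 hg
  · intro g hg
    have : c g ∈ I.image c := Finset.mem_image_of_mem _ ((memI g).2 hg)
    rw [hzS, Finset.mem_image] at this
    obtain ⟨j, _, hj⟩ := this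
    rw [← cmul] at hj
    rw [← cinj hj]
    exact AddSubgroup.nsmul_mem_zmultiples z _

theorem main (H : GHyp G d k b h) : ∃ (z : G) (i0 : Fin (d + 1)), ∀ i, i ≠ i0 → b z i = 1 / ((d * k + 1 : ℕ) : ℝ) := by
  classical
  obtain ⟨z, hz1, hz2⟩ := H.gen
  have hd := H.hd
  have hk := H.hk
  have hiter : ∀ j, ∀ g ∈ iter h j, g ∈ AddSubgroup.zmultiples z := by
    intro j
    induction j with
    | zero => intro g hg; simp [iter] at hg; rw [hg]; exact zero_mem _
    | succ j ih =>
      intro g hg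
      rw [iter, Finset.mem_add] at hg
      obtain ⟨a, ha, c, hc, rfl⟩ := hg
      refine add_mem (ih a ha) ?_
      rw [mem_lev] at hc
      rcases Nat.eq_zero_or_pos (h c) with h0 | h0
      · rw [H.eq_zero_of_h h0]; exact zero_mem _
      · exact hz2 c (by omega)
  have hgen : ∀ g, g ∈ AddSubgroup.zmultiples z := fun g => hiter d g (H.iter_univ g)
  have hord : addOrderOf z = d * k + 1 := by
    rw [addOrderOf_eq_card_of_forall_mem_zmultiples hgen, Nat.card_eq_fintype_card, H.card]
  have hNz : (d * k + 1) • z = 0 := by rw [← hord]; exact addOrderOf_nsmul_eq_zero z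
  -- heights of multiples, upper bound
  have hub : ∀ s j, 1 ≤ j → j ≤ k → h ((s * k + j) • z) ≤ s + 1 := by
    intro s
    induction s with
    | zero => intro j h1 h2; simp [hz1 j h1 h2]
    | succ s ih =>
      intro j h1 h2
      have e1 : ((s + 1) * k + j) • z = (s * k + j) • z + k • z := by
        rw [← add_nsmul]; congr 1; ring
      rw [e1]
      have h3 := H.hsub ((s * k + j) • z) (k • z)
      have h4 := ih j h1 h2
      have h5 := hz1 k hk le_rfl
      omega
  have hht : ∀ s j, 1 ≤ j → j ≤ k → s < d → h ((s * k + j) • z) = s + 1 := by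
    intro s j h1 h2 h3
    have hlt : s * k + j < d * k + 1 := by
      have : (s + 1) * k ≤ d * k := Nat.mul_le_mul_right _ (by omega)
      rw [add_mul] at this; omega
    have hne : (s * k + j) • z ≠ 0 := by
      intro h0
      have := addOrderOf_dvd_of_nsmul_eq_zero h0
      rw [hord] at this
      have := Nat.le_of_dvd (by omega) this
      omega
    have h4 := H.hneg _ (fun i => H.allpos _ hne i)
    have h5 := hub s j h1 h2
    have h6 : -((s * k + j) • z) = ((d - 1 - s) * k + (k + 1 - j)) • z := by
      rw [neg_eq_iff_add_eq_zero, ← add_nsmul, ← hNz]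
      congr 1
      obtain ⟨m, hm⟩ : ∃ m, d = s + m + 1 := ⟨d - 1 - s, by omega⟩
      rw [hm, show s + m + 1 - 1 - s = m by omega]
      have : (s + m + 1) * k = s * k + m * k + k := by ring
      omega
    have h7 := hub (d - 1 - s) (k + 1 - j) (by omega) (by omega)
    rw [← h6] at h7
    omega
  set y := k • z with hy
  have hy1 : h y = 1 := hz1 k hk le_rfl
  have hsumy := H.hsum y
  rw [hy1, Nat.cast_one] at hsumy
  have hyr : ∀ s j, s < k → 1 ≤ j → j ≤ d → h ((d * s + j) • y) = j := by
    intro s j hs h1 h2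
    obtain ⟨j', rfl⟩ : ∃ j', j = j' + 1 := ⟨j - 1, by omega⟩
    have e1 : (d * s + (j' + 1)) • y = (j' * k + (k - s)) • z := by
      rw [hy, ← mul_nsmul', show (d * s + (j' + 1)) * k = s * (d * k + 1) + (j' * k + (k - s)) by
        obtain ⟨q, rfl⟩ : ∃ q, k = s + q := ⟨k - s, by omega⟩
        rw [show s + q - s = q by omega]; ring]
      rw [add_nsmul, mul_nsmul', hNz, nsmul_zero, zero_add]
    rw [e1]
    exact hht j' (k - s) (by omega) (by omega) (by omega)
  obtain ⟨i0, hi0⟩ := weights d k (by omega) hk (b y) (H.pos y hy1) (H.b1 y)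
    (fun i => by obtain ⟨c, hc⟩ := H.exc y i; exact ⟨c, by rw [hc]; simp⟩)
    (by
      intro s hs j h1 h2
      have h3 := H.hsum ((d * s + j) • y)
      rw [hyr s j hs h1 h2] at h3
      simp only [H.bnsmul y, Int.fract] at h3
      rw [Finset.sum_sub_distrib, ← Finset.mul_sum, hsumy] at h3
      have : ((∑ i, ⌊((d * s + j : ℕ) : ℝ) * b y i⌋ : ℤ) : ℝ) = ((d * s : ℤ) : ℝ) := by
        push_cast at h3 ⊢; linarith
      exact_mod_cast this)
  have hzne : z ≠ 0 := by
    intro h0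
    have := hz1 1 le_rfl hk
    rw [h0, nsmul_zero, H.hzero] at this; omega
  refine ⟨z, i0, fun i hi => ?_⟩
  have hdy : d • y = -z := by
    rw [eq_neg_iff_add_eq_zero, hy, ← mul_nsmul', ← succ_nsmul, hNz]
  have h1 := H.bneg z i (H.allpos z hzne i)
  rw [← hdy, H.bnsmul] at h1
  have h2 := hi0 i hi
  have hNpos : (0 : ℝ) < ((d * k + 1 : ℕ) : ℝ) := by exact_mod_cast Nat.succ_pos _
  have hN1 : (1 : ℝ) < ((d * k + 1 : ℕ) : ℝ) := by
    have : 0 < d * k := Nat.mul_pos (by omega) (by omega)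
    exact_mod_cast (by omega : 1 < d * k + 1)
  have h3 : (d : ℝ) * b y i = 1 - 1 / ((d * k + 1 : ℕ) : ℝ) := by
    have : b y i = k / ((d * k + 1 : ℕ) : ℝ) := by rw [eq_div_iff hNpos.ne']; linarith
    rw [this]; field_simp; push_cast; ring
  have h4 : 1 / ((d * k + 1 : ℕ) : ℝ) < 1 := by rw [div_lt_one hNpos]; exact hN1
  have h5 : 0 < 1 / ((d * k + 1 : ℕ) : ℝ) := by positivity
  rw [h3, Int.fract_eq_self.2 ⟨by linarith, by linarith⟩] at h1
  linarith

end GHyp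

/-- the standard corner simplex -/
def cornerS (d : ℕ) : Set (Fin d → ℝ) := {x | (∀ i, 0 ≤ x i) ∧ ∑ i, x i ≤ 1}

theorem volume_cornerS (d : ℕ) (hd : 1 ≤ d) :
    (2 : ENNReal) ^ d * MeasureTheory.volume (cornerS d) = 2 ^ d / (Nat.factorial d : ENNReal) := by
  classical
  have : Nonempty (Fin d) := ⟨⟨0, hd⟩⟩
  have hmeas : MeasurableSet (cornerS d) := by
    have : cornerS d = (⋂ i, {x : Fin d → ℝ | 0 ≤ x i}) ∩ {x | ∑ i, x i ≤ 1} := by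
      ext x; simp [cornerS]
    rw [this]
    refine MeasurableSet.inter (MeasurableSet.iInter fun i => ?_) ?_
    · exact measurableSet_le measurable_const (measurable_pi_apply i)
    · exact measurableSet_le (by fun_prop) measurable_const
  have hvol := MeasureTheory.volume_sum_rpow_le (Fin d) (p := 1) le_rfl 1
  simp only [Real.rpow_one, div_one, Fintype.card_fin, ENNReal.ofReal_one, one_pow, one_mul] at hvol
  rw [show (1 : ℝ) + 1 = ((1 : ℕ) : ℝ) + 1 by norm_num, Real.Gamma_nat_eq_factorial, Real.Gamma_nat_eq_factorial] at hvol
  set F : (Fin d → Bool) → (Fin d → ℝ) → (Fin d → ℝ) := fun σ x i => (if σ i then x i else - x i) with hF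
  have hpres : ∀ σ, MeasureTheory.MeasurePreserving (F σ) MeasureTheory.volume MeasureTheory.volume := by
    intro σ
    have := MeasureTheory.volume_preserving_pi (ι := Fin d) (α' := fun _ => ℝ) (β' := fun _ => ℝ)
      (f := fun i (t : ℝ) => if σ i then t else - t) (by
        intro i
        by_cases h : σ i
        · simp only [h, if_true]; exact MeasureTheory.MeasurePreserving.id _
        · simp only [h]; exact MeasureTheory.Measure.measurePreserving_neg _)
    exact this
  have hunion : {x : Fin d → ℝ | ∑ i, |x i| ≤ 1} = ⋃ σ, F σ ⁻¹' (cornerS d) := by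
    ext x
    simp only [Set.mem_iUnion, Set.mem_preimage, cornerS, Set.mem_ofPred_eq]
    constructor
    · intro hx
      refine ⟨fun i => decide (0 ≤ x i), ?_⟩
      have : ∀ i, F (fun i => decide (0 ≤ x i)) x i = |x i| := by
        intro i
        simp only [hF, decide_eq_true_eq]
        split_ifs with h
        · rw [abs_of_nonneg h]
        · rw [abs_of_neg (by linarith)]
      simp only [this]
      exact ⟨fun i => abs_nonneg _, hx⟩
    · rintro ⟨σ, h1, h2⟩
      have : ∀ i, |x i| = F σ x i := by
        intro i
        have hi := h1 i
        simp only [hF] at hi ⊢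
        split_ifs at hi ⊢ with h
        · exact abs_of_nonneg hi
        · exact abs_of_nonpos (by linarith)
      simp only [this]; exact h2
  rw [hunion, MeasureTheory.measure_iUnion₀] at hvol
  · simp only [(hpres _).measure_preimage hmeas.nullMeasurableSet, tsum_fintype, Finset.sum_const, Finset.card_univ,
      Fintype.card_pi_const, Fintype.card_bool, nsmul_eq_mul] at hvol
    push_cast at hvol
    rw [hvol, ENNReal.ofReal_div_of_pos (by positivity)]
    congr 1
    · rw [ENNReal.ofReal_pow (by norm_num)]; norm_num
    · simp
  · intro σ τ hne
    obtain ⟨i, hi⟩ := Function.ne_iff.1 hne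
    apply MeasureTheory.measure_mono_null _ (MeasureTheory.Measure.pi_hyperplane (fun _ : Fin d => (MeasureTheory.volume : MeasureTheory.Measure ℝ)) i (0 : ℝ))
    rintro x ⟨h1, h2⟩
    have h1 := h1.1 i
    have h2 := h2.1 i
    simp only [hF] at h1 h2
    change x i = 0
    rcases hσ : σ i <;> rcases hτ : τ i <;> simp [hσ, hτ] at h1 h2 hi <;> linarith
  · intro σ
    exact ((hpres σ).measurable hmeas).nullMeasurableSet

theorem volume_cornerS' (d : ℕ) (hd : 1 ≤ d) :
    MeasureTheory.volume (cornerS d) = 1 / (Nat.factorial d : ENNReal) := by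
  have h := volume_cornerS d hd
  have h2 : (2 : ENNReal) ^ d ≠ 0 := by positivity
  have h3 : (2 : ENNReal) ^ d ≠ ⊤ := by simp
  rw [div_eq_mul_inv] at h
  rw [one_div]
  exact (ENNReal.mul_right_inj h2 h3).1 h

/-- affine basis attached to an integer simplex -/
theorem exists_basis (d : ℕ) (v : Fin (d + 1) → Fin d → ℤ)
    (hv : AffineIndependent ℝ (fun i => (fun j => (v i j : ℝ)))) :
    ∃ B : AffineBasis (Fin (d + 1)) ℝ (Fin d → ℝ), ∀ i, B i = fun j => (v i j : ℝ) := by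
  refine ⟨⟨_, hv, ?_⟩, fun i => rfl⟩
  rw [hv.affineSpan_eq_top_iff_card_eq_finrank_add_one]
  simp

/-- edge matrix -/
def edgeM (d : ℕ) (v : Fin (d + 1) → Fin d → ℤ) : Matrix (Fin d) (Fin d) ℤ :=
  Matrix.of fun i j => v i.succ j - v 0 j

theorem coord_comb {d : ℕ} (B : AffineBasis (Fin (d + 1)) ℝ (Fin d → ℝ)) (w : Fin (d + 1) → ℝ) (hw : ∑ i, w i = 1)
    (i) : B.coord i (∑ j, w j • B j) = w i := by
  have h1 := Finset.univ.affineCombination_eq_linear_combination (k := ℝ) B w hw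
  rw [← h1]
  exact B.coord_apply_combination_of_mem (Finset.mem_univ i) hw

theorem volume_simplex (d : ℕ) (hd : 1 ≤ d) (v : Fin (d + 1) → Fin d → ℤ)
    (hv : AffineIndependent ℝ (fun i => (fun j => (v i j : ℝ)))) :
    MeasureTheory.volume (convexHull ℝ (Set.range (fun i => (fun j => (v i j : ℝ))))) =
      ((edgeM d v).det.natAbs : ENNReal) / (Nat.factorial d : ENNReal) := by
  obtain ⟨B, hB⟩ := exists_basis d v hv
  have hr : (fun i => (fun j => (v i j : ℝ))) = B := by ext i; rw [hB]
  rw [hr, B.convexHull_eq_nonneg_coord]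
  set A : Matrix (Fin d) (Fin d) ℝ := (edgeM d v).map (fun z : ℤ => (z : ℝ)) with hA
  have himg : {x | ∀ i, 0 ≤ B.coord i x} = (fun x => x + B 0) '' (A.transpose.toLin' '' cornerS d) := by
    have key : ∀ y : Fin d → ℝ, A.transpose.toLin' y + B 0 =
        ∑ j, (Fin.cons (1 - ∑ i, y i) y : Fin (d + 1) → ℝ) j • B j := by
      intro y
      rw [Fin.sum_univ_succ]
      simp only [Fin.cons_zero, Fin.cons_succ]
      ext j
      simp only [Matrix.toLin'_apply, Pi.add_apply, Finset.sum_apply, Pi.smul_apply, smul_eq_mul, hB,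
        Matrix.mulVec, dotProduct, Matrix.transpose_apply, hA, Matrix.map_apply, edgeM, Matrix.of_apply]
      push_cast
      simp only [sub_mul, Finset.sum_sub_distrib, ← Finset.mul_sum]
      rw [Finset.sum_congr rfl (fun i _ => mul_comm (y i) (v i.succ j : ℝ))]
      ring
    have ksum : ∀ y : Fin d → ℝ, ∑ j, (Fin.cons (1 - ∑ i, y i) y : Fin (d + 1) → ℝ) j = 1 := by
      intro y; rw [Fin.sum_univ_succ]; simp
    rw [Set.image_image]
    ext x
    constructor
    · intro hx
      refine ⟨fun i => B.coord i.succ x, ⟨fun i => hx _, ?_⟩, ?_⟩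
      · have h1 := B.sum_coord_apply_eq_one x
        rw [Fin.sum_univ_succ] at h1
        have := hx 0
        linarith
      · change A.transpose.toLin' _ + B 0 = x
        rw [key]
        have : (Fin.cons (1 - ∑ i : Fin d, B.coord i.succ x) (fun i : Fin d => B.coord i.succ x) : Fin (d + 1) → ℝ) = fun i => B.coord i x := by
          ext i
          refine Fin.cases ?_ (fun i => ?_) i
          · have h1 := B.sum_coord_apply_eq_one x
            rw [Fin.sum_univ_succ] at h1
            simp only [Fin.cons_zero]; linarith
          · simp
        rw [this]
        exact B.linear_combination_coord_eq_self x
    · rintro ⟨y, hy, rfl⟩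
      intro i
      change 0 ≤ B.coord i (A.transpose.toLin' y + B 0)
      rw [key, coord_comb B _ (ksum y)]
      refine Fin.cases ?_ (fun i => ?_) i
      · simp only [Fin.cons_zero]; have := hy.2; linarith
      · simp only [Fin.cons_succ]; exact hy.1 i
  rw [himg, Set.image_add_right, MeasureTheory.measure_preimage_add_right, MeasureTheory.Measure.addHaar_image_linearMap,
    LinearMap.det_toLin', Matrix.det_transpose, volume_cornerS' d hd, mul_one_div]
  congr 1
  have h1 : A.det = ((edgeM d v).det : ℝ) := by
    rw [hA]; exact ((Int.castRingHom ℝ).map_det (edgeM d v)).symm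
  rw [h1, ← Int.cast_abs, Int.abs_eq_natAbs, Int.cast_natCast, ENNReal.ofReal_natCast]

theorem end_lemma (d k : ℕ) (hd : 1 ≤ d) (v : Fin (d + 1) → Fin d → ℤ) (u : Fin d → ℤ)
    (hu : ∀ j, ((d * k + 1 : ℕ) : ℤ) * u j = ∑ i, edgeM d v i j)
    (hdet : (edgeM d v).det.natAbs = d * k + 1) :
    UnimodEquiv d (convexHull ℝ (Set.range (fun i => (fun j => (v i j : ℝ)))))
      (Ta d (fun i => if i.val < d - 1 then (d * k : ℤ) else (d * k + 1 : ℤ))) := by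
  classical
  set w := edgeM d v with hw
  set N : ℤ := ((d * k + 1 : ℕ) : ℤ) with hN
  set l : Fin d := ⟨d - 1, by omega⟩ with hl
  have hlt : ∀ i : Fin d, i ≠ l ↔ i.val < d - 1 := by
    intro i
    rw [hl, ne_eq, Fin.ext_iff]
    have := i.isLt
    constructor
    · intro h; simp only at h; omega
    · intro h; simp only; omega
  set W := w.updateRow l u with hWdef
  have hWdet : N * W.det = w.det := by
    have h1 := Matrix.det_updateRow_sum w l (fun _ => 1)
    have h2 : ∑ i, (1 : ℤ) • w i = N • u := by
      ext j
      simp only [one_smul, Pi.smul_apply, smul_eq_mul]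
      rw [hu j]
      exact Finset.sum_apply j _ (fun x => (w x : Fin d → ℤ))
    rw [h2, Matrix.det_updateRow_smul, one_smul] at h1
    exact h1
  have hWu : IsUnit W.det := by
    rw [Int.isUnit_iff_natAbs_eq]
    have h1 := congrArg Int.natAbs hWdet
    rw [Int.natAbs_mul, hdet, hN, Int.natAbs_natCast] at h1
    exact Nat.eq_of_mul_eq_mul_left (Nat.succ_pos _) (by rw [h1, mul_one])
  set E : Matrix (Fin d) (Fin d) ℤ := (1 : Matrix (Fin d) (Fin d) ℤ).updateRow l (fun _ => 1) with hE
  have hEdet : E.det = 1 := by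
    have h1 := Matrix.det_updateRow_sum (1 : Matrix (Fin d) (Fin d) ℤ) l (fun _ => 1)
    have h2 : ∑ i, (1 : ℤ) • (1 : Matrix (Fin d) (Fin d) ℤ) i = fun _ => 1 := by
      ext j
      simp only [one_smul]
      refine (Finset.sum_apply j _ (fun x => ((1 : Matrix (Fin d) (Fin d) ℤ) x : Fin d → ℤ))).trans ?_
      simp [Matrix.one_apply]
    rw [h2] at h1
    rw [hE, h1]; simp
  set C := W⁻¹ * E with hC
  have hWC : W * C = E := by
    rw [hC, ← mul_assoc, Matrix.mul_nonsing_inv _ hWu, one_mul]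
  have hCdet : C.det = 1 ∨ C.det = -1 := by
    rw [← Int.isUnit_iff]
    have h1 := congrArg Matrix.det hWC
    rw [Matrix.det_mul, hEdet] at h1
    exact IsUnit.of_mul_eq_one_right _ h1
  -- rows
  have hrow : ∀ i, i ≠ l → ∀ j, ∑ m, w i m * C m j = if i = j then 1 else 0 := by
    intro i hi j
    have h1 := congrFun (congrFun hWC i) j
    rw [Matrix.mul_apply, hE, hWdef] at h1
    simp only [Matrix.updateRow_ne hi, Matrix.one_apply] at h1
    exact h1
  have hrowu : ∀ j, ∑ m, u m * C m j = 1 := by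
    intro j
    have h1 := congrFun (congrFun hWC l) j
    rw [Matrix.mul_apply, hE, hWdef] at h1
    simp only [Matrix.updateRow_self] at h1
    exact h1
  have hrowl : ∀ j, ∑ m, w l m * C m j = if j.val < d - 1 then (d * k : ℤ) else (d * k + 1 : ℤ) := by
    intro j
    have h1 : ∑ m, (N * u m) * C m j = N := by
      simp only [mul_assoc]
      rw [← Finset.mul_sum, hrowu, mul_one]
    simp only [hu, Finset.sum_mul] at h1
    rw [Finset.sum_comm, ← Finset.add_sum_erase _ _ (Finset.mem_univ l)] at h1
    rw [Finset.sum_congr rfl (fun i hi => hrow i (Finset.ne_of_mem_erase hi) j)] at h1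
    rw [Finset.sum_ite_eq'] at h1
    simp only [Finset.mem_erase, Finset.mem_univ, and_true, hlt] at h1
    rw [hN] at h1
    push_cast at h1
    split_ifs at h1 ⊢ <;> linarith
  refine ⟨C.transpose, fun j => - ∑ m, v 0 m * C m j, by rw [Matrix.det_transpose]; exact hCdet, ?_⟩
  set f : (Fin d → ℝ) → (Fin d → ℝ) := fun x => (C.transpose.map (fun z : ℤ => (z : ℝ))).mulVec x +
    (fun i => ((- ∑ m, v 0 m * C m i : ℤ) : ℝ)) with hf
  set F : (Fin d → ℝ) →ᵃ[ℝ] (Fin d → ℝ) := (Matrix.toLin' (C.transpose.map (fun z : ℤ => (z : ℝ)))).toAffineMap +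
    AffineMap.const ℝ _ (fun i => ((- ∑ m, v 0 m * C m i : ℤ) : ℝ)) with hF
  have hfF : f = F := by
    ext x; simp [hf, hF]
  have hfv : ∀ i, f (fun j => (v i j : ℝ)) = fun j => ((∑ m, (v i m - v 0 m) * C m j : ℤ) : ℝ) := by
    intro i
    ext j
    simp only [hf, Pi.add_apply, Matrix.mulVec, dotProduct, Matrix.map_apply, Matrix.transpose_apply]
    push_cast
    simp only [sub_mul, Finset.sum_sub_distrib]
    rw [sub_eq_add_neg]
    congr 1
    exact Finset.sum_congr rfl (fun m _ => mul_comm _ _)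
  have hf0 : f (fun j => (v 0 j : ℝ)) = 0 := by
    rw [hfv]; ext j; simp
  have hfs : ∀ i : Fin d, f (fun j => (v i.succ j : ℝ)) = fun j => ((∑ m, w i m * C m j : ℤ) : ℝ) := by
    intro i; rw [hfv]; rfl
  rw [hfF, AffineMap.image_convexHull, ← hfF, Ta]
  congr 1
  ext x
  simp only [Set.mem_image, Set.mem_range, Set.mem_union, Set.mem_singleton_iff]
  constructor
  · rintro ⟨_, ⟨i, rfl⟩, rfl⟩
    refine Fin.cases ?_ (fun i => ?_) i
    · left; left; exact hf0
    · by_cases hi : i = l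
      · right
        rw [hi, hfs]; ext j; rw [hrowl]
      · left; right
        refine ⟨i, (hlt i).1 hi, ?_⟩
        rw [hfs]; ext j; rw [hrow i hi, Pi.single_apply]
        simp [eq_comm]
  · rintro ((h | ⟨i, hi, h⟩) | h)
    · exact ⟨_, ⟨0, rfl⟩, by rw [hf0, h]⟩
    · refine ⟨_, ⟨i.succ, rfl⟩, ?_⟩
      rw [hfs, h]; ext j; rw [hrow i ((hlt i).2 hi), Pi.single_apply]
      simp [eq_comm]
    · refine ⟨_, ⟨l.succ, rfl⟩, ?_⟩
      rw [hfs, h]; ext j; rw [hrowl]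

/-- cast of an integer vector -/
def castV (d : ℕ) : (Fin d → ℤ) →+ (Fin d → ℝ) where
  toFun p := fun j => (p j : ℝ)
  map_zero' := by ext j; simp
  map_add' p q := by ext j; simp

/-- linear parts of barycentric coordinates, on the lattice -/
def latL (d : ℕ) (B : AffineBasis (Fin (d + 1)) ℝ (Fin d → ℝ)) (i : Fin (d + 1)) : (Fin d → ℤ) →+ ℝ :=
  ((B.coord i).linear.toAddMonoidHom).comp (castV d)

theorem latL_coord (d : ℕ) (B : AffineBasis (Fin (d + 1)) ℝ (Fin d → ℝ)) (i : Fin (d + 1)) (p q : Fin d → ℤ) :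
    latL d B i (p - q) = B.coord i (castV d p) - B.coord i (castV d q) := by
  have := (B.coord i).linearMap_vsub (castV d p) (castV d q)
  simp only [vsub_eq_sub] at this
  rw [← this, ← map_sub]
  rfl

theorem latL_sum (d : ℕ) (B : AffineBasis (Fin (d + 1)) ℝ (Fin d → ℝ)) (p : Fin d → ℤ) :
    ∑ i, latL d B i p = 0 := by
  have h := fun i => latL_coord d B i p 0
  simp only [sub_zero] at h
  simp only [h, Finset.sum_sub_distrib, B.sum_coord_apply_eq_one, sub_self]

theorem coord_vert (d : ℕ) (v : Fin (d + 1) → Fin d → ℤ) (B : AffineBasis (Fin (d + 1)) ℝ (Fin d → ℝ))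
    (hB : ∀ i, B i = castV d (v i)) (i m : Fin (d + 1)) :
    B.coord i (castV d (v m)) = if i = m then 1 else 0 := by
  rw [← hB, B.coord_apply]

theorem latL_recon (d : ℕ) (v : Fin (d + 1) → Fin d → ℤ) (B : AffineBasis (Fin (d + 1)) ℝ (Fin d → ℝ))
    (hB : ∀ i, B i = castV d (v i)) (p : Fin d → ℤ) (j : Fin d) :
    (p j : ℝ) = ∑ i, latL d B i p * (v i j : ℝ) := by
  have h := fun i => latL_coord d B i p 0
  simp only [sub_zero] at h
  have h1 := congrFun (B.linear_combination_coord_eq_self (castV d p)) j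
  have h2 := congrFun (B.linear_combination_coord_eq_self (castV d 0)) j
  simp only [Finset.sum_apply, Pi.smul_apply, hB, smul_eq_mul] at h1 h2
  simp only [h, sub_mul, Finset.sum_sub_distrib]
  change _ = ∑ i, B.coord i (castV d p) * castV d (v i) j - ∑ i, B.coord i (castV d 0) * castV d (v i) j
  rw [h1, h2]
  simp [castV]

/-- the sublattice spanned by edges -/
def latS (d : ℕ) (B : AffineBasis (Fin (d + 1)) ℝ (Fin d → ℝ)) : Submodule ℤ (Fin d → ℤ) where
  carrier := {p | ∀ i, ∃ n : ℤ, latL d B i p = n}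
  zero_mem' := fun i => ⟨0, by simp⟩
  add_mem' := by
    intro a b ha hb i
    obtain ⟨m, hm⟩ := ha i
    obtain ⟨n, hn⟩ := hb i
    exact ⟨m + n, by rw [map_add, hm, hn]; push_cast; rfl⟩
  smul_mem' := by
    intro c a ha i
    obtain ⟨m, hm⟩ := ha i
    exact ⟨c * m, by rw [map_zsmul, hm]; push_cast; simp⟩

theorem latS_card (d : ℕ) (v : Fin (d + 1) → Fin d → ℤ) (B : AffineBasis (Fin (d + 1)) ℝ (Fin d → ℝ))
    (hB : ∀ i, B i = castV d (v i)) :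
    Nat.card ((Fin d → ℤ) ⧸ latS d B) = (edgeM d v).det.natAbs := by
  classical
  have hL : ∀ (i : Fin (d+1)) (m : Fin d), latL d B i (edgeM d v m) = (if i = m.succ then 1 else 0) - (if i = 0 then 1 else 0) := by
    intro i m
    have : edgeM d v m = v m.succ - v 0 := by ext j; simp [edgeM]
    rw [this, latL_coord, coord_vert d v B hB, coord_vert d v B hB]
  have hmem : ∀ m, edgeM d v m ∈ latS d B := by
    intro m i
    rw [hL]
    exact ⟨(if i = m.succ then 1 else 0) - (if i = 0 then 1 else 0), by push_cast; rfl⟩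
  let e : Fin d → latS d B := fun m => ⟨edgeM d v m, hmem m⟩
  have hli : LinearIndependent ℤ e := by
    rw [Fintype.linearIndependent_iff]
    intro g hg m
    have h1 : ∑ i, g i • edgeM d v i = 0 := by
      have := congrArg (Submodule.subtype _) hg
      simpa [e] using this
    have h2 := congrArg (latL d B m.succ) h1
    simp only [map_sum, map_zsmul, hL, map_zero] at h2
    simp [Fin.succ_inj, Fin.succ_ne_zero] at h2
    exact h2
  have hsp : ⊤ ≤ Submodule.span ℤ (Set.range e) := by
    rintro ⟨p, hp⟩ -
    have hp2 : ∀ i, ∃ n : ℤ, latL d B i p = n := hp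
    choose n hn using hp2
    have : (⟨p, hp⟩ : latS d B) = ∑ m : Fin d, n m.succ • e m := by
      apply Subtype.ext
      ext j
      have h1 := latL_recon d v B hB p j
      have h2 := latL_sum d B p
      simp only [hn] at h1 h2
      have h1' : p j = ∑ i, n i * v i j := by exact_mod_cast h1
      have h2' : ∑ i, n i = 0 := by exact_mod_cast h2
      rw [Fin.sum_univ_succ] at h1' h2'
      simp only [e, Submodule.coe_sum, Submodule.coe_smul, Finset.sum_apply, Pi.smul_apply, edgeM, Matrix.of_apply, smul_eq_mul, mul_sub, Finset.sum_sub_distrib, ← Finset.sum_mul]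
      rw [h1']
      linear_combination v 0 j * h2'
    rw [this]
    exact Submodule.sum_mem _ fun m _ => Submodule.smul_mem _ _ (Submodule.subset_span ⟨m, rfl⟩)
  have h := Submodule.natAbs_det_basis_change (Pi.basisFun ℤ (Fin d)) (latS d B) (Module.Basis.mk hli hsp)
  rw [← h]
  congr 1
  rw [Module.Basis.det_apply, ← Matrix.det_transpose]
  congr 1
  ext i j
  simp [Module.Basis.toMatrix_apply, e]

/-- fractional barycentric coordinates on the quotient group -/
def latb (d : ℕ) (B : AffineBasis (Fin (d + 1)) ℝ (Fin d → ℝ)) (g : (Fin d → ℤ) ⧸ latS d B) (i : Fin (d + 1)) : ℝ :=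
  Int.fract (latL d B i g.out)

theorem latb_mk (d : ℕ) (B : AffineBasis (Fin (d + 1)) ℝ (Fin d → ℝ)) (p : Fin d → ℤ) (i : Fin (d + 1)) :
    latb d B (Submodule.Quotient.mk p) i = Int.fract (latL d B i p) := by
  unfold latb
  set q := Quotient.out (Submodule.Quotient.mk p : (Fin d → ℤ) ⧸ latS d B) with hq
  have h1 : (Submodule.Quotient.mk q : (Fin d → ℤ) ⧸ latS d B) = Submodule.Quotient.mk p := Quotient.out_eq _
  rw [Submodule.Quotient.eq] at h1
  obtain ⟨n, hn⟩ := h1 i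
  rw [map_sub] at hn
  rw [Int.fract_eq_fract]
  exact ⟨n, hn⟩

/-- height -/
def lath (d : ℕ) (B : AffineBasis (Fin (d + 1)) ℝ (Fin d → ℝ)) (g : (Fin d → ℤ) ⧸ latS d B) : ℕ :=
  (-∑ i, ⌊latL d B i g.out⌋).toNat

theorem lath_eq (d : ℕ) (B : AffineBasis (Fin (d + 1)) ℝ (Fin d → ℝ)) (g : (Fin d → ℤ) ⧸ latS d B) :
    ∑ i, latb d B g i = lath d B g := by
  have h1 : ∑ i, latb d B g i = ((-∑ i, ⌊latL d B i g.out⌋ : ℤ) : ℝ) := by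
    simp only [latb, Int.fract, Finset.sum_sub_distrib, latL_sum]
    push_cast
    ring
  have h2 : 0 ≤ ∑ i, latb d B g i := Finset.sum_nonneg fun i _ => Int.fract_nonneg _
  rw [h1] at h2 ⊢
  have h3 : 0 ≤ -∑ i, ⌊latL d B i g.out⌋ := by exact_mod_cast h2
  have h4 : ((lath d B g : ℤ)) = -∑ i, ⌊latL d B i g.out⌋ := Int.toNat_of_nonneg h3
  rw [← h4]; simp

/-- representative in the half open parallelepiped -/
def latpt (d : ℕ) (v : Fin (d + 1) → Fin d → ℤ) (B : AffineBasis (Fin (d + 1)) ℝ (Fin d → ℝ)) (g : (Fin d → ℤ) ⧸ latS d B) :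
    Fin d → ℤ := fun j => g.out j - ∑ i, ⌊latL d B i g.out⌋ * v i j

theorem latpt_eq (d : ℕ) (v : Fin (d + 1) → Fin d → ℤ) (B : AffineBasis (Fin (d + 1)) ℝ (Fin d → ℝ))
    (hB : ∀ i, B i = castV d (v i)) (g : (Fin d → ℤ) ⧸ latS d B) (j : Fin d) :
    (latpt d v B g j : ℝ) = ∑ i, latb d B g i * (v i j : ℝ) := by
  simp only [latpt, latb, Int.fract, sub_mul, Finset.sum_sub_distrib]
  push_cast
  rw [← latL_recon d v B hB]

theorem latpt_coord (d : ℕ) (v : Fin (d + 1) → Fin d → ℤ) (B : AffineBasis (Fin (d + 1)) ℝ (Fin d → ℝ))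
    (hB : ∀ i, B i = castV d (v i)) (g : (Fin d → ℤ) ⧸ latS d B) (hg : lath d B g = 1) (i : Fin (d + 1)) :
    B.coord i (castV d (latpt d v B g)) = latb d B g i := by
  have h1 : castV d (latpt d v B g) = ∑ j, latb d B g j • B j := by
    ext j
    simp only [Finset.sum_apply, Pi.smul_apply, hB, smul_eq_mul]
    exact latpt_eq d v B hB g j
  rw [h1]
  apply coord_comb
  rw [lath_eq, hg]; simp

theorem latb_inj (d : ℕ) (B : AffineBasis (Fin (d + 1)) ℝ (Fin d → ℝ)) (g g' : (Fin d → ℤ) ⧸ latS d B)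
    (h : ∀ i, latb d B g i = latb d B g' i) : g = g' := by
  have h1 : g = Submodule.Quotient.mk g.out := (Quotient.out_eq g).symm
  have h2 : g' = Submodule.Quotient.mk g'.out := (Quotient.out_eq g').symm
  rw [h1, h2, Submodule.Quotient.eq]
  intro i
  have := h i
  unfold latb at this
  rw [Int.fract_eq_fract] at this
  obtain ⟨n, hn⟩ := this
  exact ⟨n, by rw [map_sub, hn]⟩

theorem castV_inj (d : ℕ) : Function.Injective (castV d) := by
  intro p q h
  ext j
  have := congrFun h j
  simpa [castV] using this

theorem castV_lattice (d : ℕ) (p : Fin d → ℤ) : IsLatticePt d (castV d p) := fun j => ⟨p j, rfl⟩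

theorem lattice_castV (d : ℕ) (x : Fin d → ℝ) (hx : IsLatticePt d x) : ∃ p, x = castV d p := by
  choose p hp using hx
  exact ⟨p, funext hp⟩

theorem glue (d k : ℕ) (hd : 3 ≤ d) (hk : 1 ≤ k) (v : Fin (d + 1) → Fin d → ℤ)
    (B : AffineBasis (Fin (d + 1)) ℝ (Fin d → ℝ)) (hB : ∀ i, B i = castV d (v i))
    (hclean : IsClean d (convexHull ℝ (Set.range B)))
    (hint : {x ∈ interior (convexHull ℝ (Set.range B)) | IsLatticePt d x}.ncard = k)
    (hdet : (edgeM d v).det.natAbs = d * k + 1) :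
    ∃ (i0 : Fin (d + 1)) (u : Fin d → ℤ), ∀ j, ((d * k + 1 : ℕ) : ℤ) * u j = ∑ i, (v i j - v i0 j) := by
  classical
  have hcard := latS_card d v B hB
  rw [hdet] at hcard
  have : Finite ((Fin d → ℤ) ⧸ latS d B) := Nat.finite_of_card_ne_zero (by rw [hcard]; omega)
  letI : Fintype ((Fin d → ℤ) ⧸ latS d B) := Fintype.ofFinite _
  have hb0 : ∀ g i, 0 ≤ latb d B g i := fun g i => Int.fract_nonneg _
  have hb1 : ∀ g i, latb d B g i < 1 := fun g i => Int.fract_lt_one _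
  have hpos : ∀ g, lath d B g = 1 → ∀ i, 0 < latb d B g i := by
    intro g hg i
    by_contra hcon
    have hc := latpt_coord d v B hB g hg
    have hmem : castV d (latpt d v B g) ∈ convexHull ℝ (Set.range B) := by
      rw [B.convexHull_eq_nonneg_coord]
      intro i; rw [hc]; exact hb0 g i
    have hnint : castV d (latpt d v B g) ∉ interior (convexHull ℝ (Set.range B)) := by
      rw [B.interior_convexHull]
      intro h
      have := h i
      rw [hc] at this
      exact hcon this
    have hfr : castV d (latpt d v B g) ∈ frontier (convexHull ℝ (Set.range B)) :=
      ⟨subset_closure hmem, hnint⟩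
    have hext : castV d (latpt d v B g) ∈ Set.extremePoints ℝ (convexHull ℝ (Set.range B)) := by
      rw [← hclean]
      exact ⟨hfr, castV_lattice d _⟩
    obtain ⟨m, hm⟩ := extremePoints_convexHull_subset hext
    have h1 := hc m
    rw [← hm, B.coord_apply_eq] at h1
    have := hb1 g m
    linarith
  have hI : {x ∈ interior (convexHull ℝ (Set.range B)) | IsLatticePt d x} =
      (fun g => castV d (latpt d v B g)) '' {g | lath d B g = 1} := by
    ext x
    constructor
    · rintro ⟨hx, hxl⟩
      obtain ⟨p, rfl⟩ := lattice_castV d x hxl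
      rw [B.interior_convexHull] at hx
      have hx : ∀ i, 0 < B.coord i (castV d p) := hx
      have hs := B.sum_coord_apply_eq_one (castV d p)
      have hlt : ∀ i, B.coord i (castV d p) < 1 := by
        intro i
        have : ∃ j, j ≠ i := by
          have : Nontrivial (Fin (d + 1)) := Fin.nontrivial_iff_two_le.2 (by omega)
          exact exists_ne i
        obtain ⟨j, hj⟩ := this
        have h3 : B.coord i (castV d p) + B.coord j (castV d p) ≤ 1 := by
          rw [← hs, ← Finset.sum_pair (f := fun a => B.coord a (castV d p)) hj.symm]
          exact Finset.sum_le_sum_of_subset_of_nonneg (Finset.subset_univ _) (fun a _ _ => (hx a).le)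
        have := hx j
        linarith
      have hb : ∀ i, latb d B (Submodule.Quotient.mk (p - v 0)) i = B.coord i (castV d p) := by
        intro i
        rw [latb_mk, latL_coord, coord_vert d v B hB]
        have hfr : Int.fract (B.coord i (castV d p)) = B.coord i (castV d p) :=
          Int.fract_eq_self.2 ⟨(hx i).le, hlt i⟩
        split_ifs
        · rw [Int.fract_sub_one, hfr]
        · rw [sub_zero, hfr]
      have hh : lath d B (Submodule.Quotient.mk (p - v 0)) = 1 := by
        have := lath_eq d B (Submodule.Quotient.mk (p - v 0))
        simp only [hb, hs] at this
        exact_mod_cast this.symm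
      refine ⟨Submodule.Quotient.mk (p - v 0), hh, ?_⟩
      change castV d (latpt d v B (Submodule.Quotient.mk (p - v 0))) = castV d p
      rw [← B.linear_combination_coord_eq_self (castV d p),
        ← B.linear_combination_coord_eq_self (castV d (latpt d v B _))]
      refine Finset.sum_congr rfl fun i _ => ?_
      rw [latpt_coord d v B hB _ hh, hb]
    · rintro ⟨g, hg, rfl⟩
      refine ⟨?_, castV_lattice d _⟩
      rw [B.interior_convexHull]
      intro i
      rw [latpt_coord d v B hB g hg]
      exact hpos g hg i
  have H : GHyp ((Fin d → ℤ) ⧸ latS d B) d k (latb d B) (lath d B) :=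
    { hd := hd
      hk := hk
      b0 := hb0
      b1 := hb1
      badd := by
        intro g g' i
        have h1 : g = Submodule.Quotient.mk g.out := (Quotient.out_eq g).symm
        have h2 : g' = Submodule.Quotient.mk g'.out := (Quotient.out_eq g').symm
        have h3 : g + g' = Submodule.Quotient.mk (g.out + g'.out) := by
          rw [Submodule.Quotient.mk_add, ← h1, ← h2]
        rw [h3, latb_mk, map_add]
        unfold latb
        rw [Int.fract_eq_fract]
        refine ⟨⌊latL d B i g.out⌋ + ⌊latL d B i g'.out⌋, ?_⟩
        simp only [Int.fract]
        push_cast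
        ring
      binj := by
        intro g hg
        apply latb_inj
        intro i
        rw [hg, ← Submodule.Quotient.mk_zero, latb_mk, map_zero, Int.fract_zero]
      hsum := lath_eq d B
      card := by rw [← Nat.card_eq_fintype_card, hcard]
      cardI := by
        rw [hI, Set.ncard_image_of_injOn] at hint
        · exact hint
        · intro g hg g' hg' h
          apply latb_inj
          intro i
          rw [← latpt_coord d v B hB g hg, ← latpt_coord d v B hB g' hg']
          exact congrArg _ h
      pos := hpos }
  obtain ⟨z, i0, hz⟩ := H.main
  refine ⟨i0, fun j => latpt d v B z j - lath d B z * v i0 j, ?_⟩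
  intro j
  have h1 := latpt_eq d v B hB z j
  have h2 := lath_eq d B z
  have hN : ((d * k + 1 : ℕ) : ℝ) ≠ 0 := by positivity
  have h3 : (((d * k + 1 : ℕ) : ℤ) : ℝ) * ((latpt d v B z j : ℝ) - (lath d B z : ℝ) * (v i0 j : ℝ)) =
      ∑ i, ((v i j : ℝ) - v i0 j) := by
    rw [h1, ← h2, Finset.sum_mul, ← Finset.sum_sub_distrib, Finset.mul_sum]
    refine Finset.sum_congr rfl fun i _ => ?_
    by_cases hi : i = i0
    · subst hi; ring
    · rw [hz i hi, Int.cast_natCast]; field_simp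
  exact_mod_cast h3

theorem det_of_vol (d n : ℕ) (hd : 1 ≤ d) (v : Fin (d + 1) → Fin d → ℤ)
    (hv : AffineIndependent ℝ (fun i => fun j => ((v i j : ℤ) : ℝ)))
    (hvol : MeasureTheory.volume (convexHull ℝ (Set.range (fun i => fun j => ((v i j : ℤ) : ℝ)))) =
      (n : ENNReal) / (Nat.factorial d : ENNReal)) :
    (edgeM d v).det.natAbs = n := by
  rw [volume_simplex d hd v hv] at hvol
  have hf : (Nat.factorial d : ENNReal) ≠ 0 := by exact_mod_cast Nat.factorial_ne_zero d
  have hf2 : (Nat.factorial d : ENNReal) ≠ ⊤ := ENNReal.natCast_ne_top _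
  have := congrArg (fun x => x * (Nat.factorial d : ENNReal)) hvol
  simp only [ENNReal.div_mul_cancel hf hf2] at this
  exact_mod_cast this

theorem geo_main (d k : ℕ) (hd : 3 ≤ d) (hk : 1 ≤ k)
    (T : Set (Fin d → ℝ)) (hT : IsLatticeSimplex d T) (hclean : IsClean d T)
    (hint : {x ∈ interior T | IsLatticePt d x}.ncard = k)
    (hvol : volume T = ((d * k + 1 : ℕ) : ℝ≥0∞) / (Nat.factorial d : ℝ≥0∞)) :
    UnimodEquiv d T
      (Ta d (fun i => if i.val < d - 1 then (d * k : ℤ) else (d * k + 1 : ℤ))) := by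
  obtain ⟨v, hv, rfl⟩ := hT
  obtain ⟨B, hB⟩ := exists_basis d v hv
  have hB2 : ∀ i, B i = castV d (v i) := hB
  have hrange : Set.range (fun i => fun j => ((v i j : ℤ) : ℝ)) = Set.range B := by
    congr 1; ext i : 1; exact (hB i).symm
  have hdet := det_of_vol d (d * k + 1) (by omega) v hv hvol
  obtain ⟨i0, u, hu⟩ := glue d k hd hk v B hB2 (hrange ▸ hclean) (hrange ▸ hint) hdet
  set v' : Fin (d + 1) → Fin d → ℤ := fun i => v (Equiv.swap 0 i0 i) with hv'
  have hr : Set.range (fun i => fun j => ((v i j : ℤ) : ℝ)) = Set.range (fun i => fun j => ((v' i j : ℤ) : ℝ)) :=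
    ((Equiv.swap 0 i0).surjective.range_comp (fun i => fun j => ((v i j : ℤ) : ℝ))).symm
  have hv2 : AffineIndependent ℝ (fun i => fun j => ((v' i j : ℤ) : ℝ)) :=
    hv.comp_embedding (Equiv.swap 0 i0).toEmbedding
  rw [hr] at hvol ⊢
  refine end_lemma d k (by omega) v' u ?_ (det_of_vol d (d * k + 1) (by omega) v' hv2 hvol)
  intro j
  rw [hu j]
  have h1 : ∑ i, (v i j - v i0 j) = ∑ i, (v' i j - v i0 j) :=
    (Equiv.sum_comp (Equiv.swap 0 i0) (fun i => v i j - v i0 j)).symm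
  have h2 : v' 0 = v i0 := by simp [hv']
  rw [h1, Fin.sum_univ_succ, h2, sub_self, zero_add]
  simp [edgeM, h2]

/-- A minimal-volume clean `k`-point lattice `d`-simplex (`d ≥ 3`, `k ≥ 1`)
is unimodularly equivalent to `T_{a_1,…,a_d}` with `a_i = dk` for `i < d` and
`a_d = dk + 1`. -/
theorem minimal_volume_equiv_Ta (d k : ℕ) (hd : 3 ≤ d) (hk : 1 ≤ k)
    (T : Set (Fin d → ℝ)) (hT : IsLatticeSimplex d T) (hclean : IsClean d T)
    (hint : {x ∈ interior T | IsLatticePt d x}.ncard = k)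
    (hvol : volume T = ((d * k + 1 : ℕ) : ℝ≥0∞) / (Nat.factorial d : ℝ≥0∞)) :
    UnimodEquiv d T
      (Ta d (fun i => if i.val < d - 1 then (d * k : ℤ) else (d * k + 1 : ℤ))) := by
  exact geo_main d k hd hk T hT hclean hint hvol
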